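/- arXiv:2106.09194 — 3 statements merged into one kernel-verified Lean document; each statement's English description precedes it below -/
import Mathlib

section
/- Bendixson–Dulac theorem: let U ⊆ ℝ² be an open, simply connected set, let β = (β₁, β₂) : ℝ² → ℝ² and φ : ℝ² → ℝ be continuously differentiable, and suppose that the divergence div(φβ)(p) = ∂(φβ₁)/∂x (p) + ∂(φβ₂)/∂y (p) is strictly positive for every p ∈ U. Then there is no nonconstant periodic solution λ : ℝ → ℝ² of λ'(t) = β(λ(t)) whose image is contained in U. -/
open Set Filter Topology MeasureTheory Complex

namespace BD

/-- Twice the `∂̄` operator. -/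
noncomputable def D (f : ℂ → ℂ) (p : ℂ) : ℂ := fderiv ℝ f p 1 + I * fderiv ℝ f p I

noncomputable def P (q : ℝ × ℝ) : ℂ := q.1 * exp (q.2 * I)

lemma continuous_P : Continuous P := by unfold P; fun_prop

lemma norm_P (q : ℝ × ℝ) : ‖P q‖ = |q.1| := by
  simp [P, Complex.norm_exp]

lemma integrableOn_aux (G : ℝ × ℝ → ℂ) (hG : Continuous G) (R : ℝ)
    (h0 : ∀ q : ℝ × ℝ, R ≤ |q.1| → G q = 0) :
    IntegrableOn G (Ioi (0:ℝ) ×ˢ Ioo (-Real.pi) Real.pi) := by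
  have h1 : IntegrableOn G (Icc 0 R ×ˢ Icc (-Real.pi) Real.pi) :=
    hG.continuousOn.integrableOn_compact (isCompact_Icc.prod isCompact_Icc)
  refine IntegrableOn.of_forall_sdiff_eq_zero h1 (measurableSet_Ioi.prod measurableSet_Ioo) ?_
  rintro ⟨r, θ⟩ ⟨⟨hr, hθ⟩, hn⟩
  apply h0
  by_contra hlt
  push Not at hlt
  apply hn
  simp only [mem_Ioi, mem_Ioo] at hr hθ
  rw [abs_of_pos hr] at hlt
  exact ⟨⟨hr.le, hlt.le⟩, ⟨hθ.1.le, hθ.2.le⟩⟩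

lemma D_eq (f : ℂ → ℂ) (p : ℂ) (θ : ℝ) :
    D f p * exp (-(θ * I)) =
      fderiv ℝ f p (exp (θ * I)) + I * fderiv ℝ f p (I * exp (θ * I)) := by
  have e1 : exp (θ * I) = (Real.cos θ) • (1:ℂ) + (Real.sin θ) • I := by
    rw [exp_mul_I]; simp
  have e2 : I * exp (θ * I) = (Real.cos θ) • I - (Real.sin θ) • (1 : ℂ) := by
    rw [exp_mul_I]; simp
    ring_nf
    simp; ring
  have e3 : exp (-(θ * I)) = Real.cos θ - Real.sin θ * I := by
    rw [← neg_mul, exp_mul_I]; simp [Complex.cos_neg, Complex.sin_neg]; ring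
  rw [e2, e1, e3]
  simp only [map_add, map_sub, map_smul]
  simp only [D, real_smul]
  ring_nf
  simp

lemma exists_support_bound {f : ℂ → ℂ} (hc : HasCompactSupport f) (z : ℂ) :
    ∃ R : ℝ, ∀ u : ℂ, R ≤ ‖u‖ → f (z + u) = 0 ∧ fderiv ℝ f (z + u) = 0 := by
  obtain ⟨R, hR⟩ := hc.isCompact.isBounded.exists_norm_le
  refine ⟨R + 1 + ‖z‖, fun u hu => ?_⟩
  have hn : z + u ∉ tsupport f := by
    intro h
    have h1 := hR _ h
    have h2 : ‖u‖ ≤ ‖z + u‖ + ‖z‖ := by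
      have := norm_sub_le (z + u) z
      simpa using this
    linarith
  exact ⟨image_eq_zero_of_notMem_tsupport hn, by
    by_contra h
    exact hn (support_fderiv_subset ℝ (by simpa using h))⟩

theorem pompeiu (f : ℂ → ℂ) (hf : ContDiff ℝ 1 f) (hc : HasCompactSupport f) (z : ℂ) :
    ∫ p, D f p / (z - p) = 2 * Real.pi * f z := by
  obtain ⟨R, hR⟩ := exists_support_bound hc z
  have hfd : Continuous (fderiv ℝ f) := hf.continuous_fderiv (by norm_num)
  have hdiff : ∀ w, HasFDerivAt f (fderiv ℝ f w) w := fun w =>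
    (hf.differentiable (by norm_num) w).hasFDerivAt
  rw [← integral_add_left_eq_self (fun p => D f p / (z - p)) z,
    ← Complex.integral_comp_polarCoord_symm]
  set A : ℝ × ℝ → ℂ := fun q => fderiv ℝ f (z + P q) (exp (q.2 * I)) with hA
  set B : ℝ × ℝ → ℂ := fun q => fderiv ℝ f (z + P q) (I * exp (q.2 * I)) with hB
  have cA : Continuous A := by
    have := continuous_P
    exact (hfd.comp (by fun_prop)).clm_apply (by fun_prop)
  have cB : Continuous B := by
    have := continuous_P
    exact (hfd.comp (by fun_prop)).clm_apply (by fun_prop)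
  have iA := integrableOn_aux A cA R (fun q hq => by
    simp [hA, (hR (P q) (by rwa [norm_P])).2])
  have iB := integrableOn_aux B cB R (fun q hq => by
    simp [hB, (hR (P q) (by rwa [norm_P])).2])
  have step : ∫ p in polarCoord.target, p.1 • (D f (z + Complex.polarCoord.symm p) /
      (z - (z + Complex.polarCoord.symm p))) =
      ∫ q in Ioi (0:ℝ) ×ˢ Ioo (-Real.pi) Real.pi, -(A q + I * B q) := by
    rw [polarCoord_target]
    refine setIntegral_congr_fun (measurableSet_Ioi.prod measurableSet_Ioo) ?_
    rintro ⟨r, θ⟩ ⟨hr, hθ⟩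
    have hr' : (r : ℂ) ≠ 0 := by
      simp only [mem_Ioi] at hr; exact_mod_cast hr.ne'
    have e : Complex.polarCoord.symm (r, θ) = P (r, θ) := by
      simp [P, exp_mul_I]
    simp only [e, hA, hB]
    rw [← D_eq, exp_neg]
    simp only [P, real_smul]
    have := exp_ne_zero (θ * I)
    field_simp
    ring
  rw [step, integral_neg, integral_add iA (iB.const_mul I), integral_const_mul]
  have hBz : ∫ q in Ioi (0:ℝ) ×ˢ Ioo (-Real.pi) Real.pi, B q = 0 := by
    rw [Measure.volume_eq_prod, setIntegral_prod _ (by rwa [← Measure.volume_eq_prod])]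
    refine setIntegral_eq_zero_of_forall_eq_zero fun r hr => ?_
    simp only [mem_Ioi] at hr
    rw [← integral_Ioc_eq_integral_Ioo, ← intervalIntegral.integral_of_le (by linarith [Real.pi_pos])]
    have hd : ∀ θ : ℝ, HasDerivAt (fun θ : ℝ => (r:ℂ)⁻¹ * f (z + P (r, θ))) (B (r, θ)) θ := by
      intro θ
      have h1 : HasDerivAt (fun θ : ℝ => z + P (r, θ)) (r • (I * exp (θ * I))) θ := by
        have h2 : HasDerivAt (fun θ : ℝ => exp ((θ : ℂ) * I)) (exp (θ * I) * (1 * I)) θ :=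
          ((hasDerivAt_id (θ:ℂ)).mul_const I).cexp.comp_ofReal
        have := (h2.const_mul (r : ℂ)).const_add z
        refine this.congr_deriv ?_
        rw [real_smul]; ring
      have h3 := ((hdiff _).comp_hasDerivAt θ h1).const_mul (r:ℂ)⁻¹
      refine h3.congr_deriv ?_
      have hr' : (r : ℂ) ≠ 0 := by exact_mod_cast hr.ne'
      rw [map_smul]
      simp only [hB, real_smul]
      field_simp
    rw [intervalIntegral.integral_eq_sub_of_hasDerivAt (fun θ _ => hd θ)
      ((cB.comp (by fun_prop : Continuous fun θ : ℝ => (r, θ))).intervalIntegrable _ _)]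
    have : P (r, Real.pi) = P (r, -Real.pi) := by
      simp [P, exp_neg, exp_pi_mul_I]
    rw [this, sub_self]
  have hAz : ∫ q in Ioi (0:ℝ) ×ˢ Ioo (-Real.pi) Real.pi, A q = -(2 * Real.pi * f z) := by
    rw [Measure.volume_eq_prod, ← setIntegral_prod_swap, setIntegral_prod]
    swap
    · have := iA
      rw [Measure.volume_eq_prod] at this
      exact this.swap
    have : ∀ θ : ℝ, ∫ r in Ioi (0:ℝ), A (r, θ) = - f z := by
      intro θ
      have hd : ∀ r : ℝ, HasDerivAt (fun r : ℝ => f (z + P (r, θ))) (A (r, θ)) r := by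
        intro r
        have h1 : HasDerivAt (fun r : ℝ => z + P (r, θ)) (exp (θ * I)) r := by
          have := ((hasDerivAt_id (r:ℂ)).comp_ofReal.mul_const (exp (θ * I))).const_add z
          refine this.congr_deriv ?_
          simp
        exact (hdiff _).comp_hasDerivAt r h1
      have hi : IntegrableOn (fun r : ℝ => A (r, θ)) (Ioi 0) := by
        have h1 : IntegrableOn (fun r : ℝ => A (r, θ)) (Icc 0 R) :=
          (cA.comp (by fun_prop : Continuous fun r : ℝ => (r, θ))).continuousOn.integrableOn_compact
            isCompact_Icc
        refine h1.of_forall_sdiff_eq_zero measurableSet_Ioi ?_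
        rintro r ⟨hr, hn⟩
        simp only [mem_Ioi, mem_Icc, not_and, not_le] at hr hn
        have := (hR (P (r, θ)) (by rw [norm_P, abs_of_pos hr]; exact (hn hr.le).le)).2
        simp [hA, this]
      have ht : Tendsto (fun r : ℝ => f (z + P (r, θ))) atTop (𝓝 0) := by
        refine tendsto_const_nhds.congr' ?_
        filter_upwards [eventually_ge_atTop R, eventually_ge_atTop 0] with r h1 h2
        exact ((hR (P (r, θ)) (by rw [norm_P, abs_of_nonneg h2]; exact h1)).1).symm
      rw [integral_Ioi_of_hasDerivAt_of_tendsto (hd 0).continuousAt.continuousWithinAt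
        (fun r _ => hd r) hi ht]
      simp [P]
    simp only [Prod.swap_prod_mk, this]
    rw [setIntegral_const]
    simp [Real.volume_real_Ioo_of_le (show -Real.pi ≤ Real.pi by linarith [Real.pi_pos])]
    left
    ring
  rw [hAz, hBz]
  ring


/-- `2 π i` times the winding number. -/
noncomputable def W (γ v : ℝ → ℂ) (τ : ℝ) (p : ℂ) : ℂ := ∫ t in (0:ℝ)..τ, v t / (γ t - p)

lemma integrableOn_inv_ball (r : ℝ) :
    IntegrableOn (fun u : ℂ => ‖u‖⁻¹) (Metric.ball 0 r) := by
  refine integrableOn_ball_of_norm_le_rpow (C := 1) (α := 1) ?_ ?_ ?_ ?_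
  · simp
  · simp
  · filter_upwards with u
    simp [Real.rpow_neg_one]
  · exact (measurable_norm.inv).aestronglyMeasurable

lemma continuous_D {f : ℂ → ℂ} (hf : ContDiff ℝ 1 f) : Continuous (D f) := by
  have hfd : Continuous (fderiv ℝ f) := hf.continuous_fderiv (by norm_num)
  unfold D
  fun_prop

lemma integrable_prod_aux {f : ℂ → ℂ} (hf : ContDiff ℝ 1 f) (hc : HasCompactSupport f)
    {γ v : ℝ → ℂ} (hγ : Continuous γ) (hv : Continuous v) (τ : ℝ) :
    Integrable (fun q : ℝ × ℂ => D f q.2 / (γ q.1 - q.2) * v q.1)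
      ((volume.restrict (Ioc 0 τ)).prod volume) := by
  have hD := continuous_D hf
  have hDc : HasCompactSupport (D f) := by
    refine hc.fderiv ℝ |>.mono ?_
    intro x hx h
    apply hx
    simp [D] at h ⊢
    simp [h]
  obtain ⟨M, hM⟩ := hD.bounded_above_of_compact_support hDc
  obtain ⟨Rf, hRf⟩ := hDc.isCompact.isBounded.exists_norm_le
  obtain ⟨V, hV⟩ := (isCompact_Icc (a := (0:ℝ)) (b := τ)).exists_bound_of_continuousOn hv.continuousOn
  obtain ⟨G, hG⟩ := (isCompact_Icc (a := (0:ℝ)) (b := τ)).exists_bound_of_continuousOn hγ.continuousOn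
  have hM0 : 0 ≤ M := (norm_nonneg _).trans (hM 0)
  set R := G + Rf + 1
  -- dominating function
  have hdomi : ∀ t : ℝ, Integrable (fun p : ℂ => V * M * (Metric.ball (0:ℂ) R).indicator (fun u => ‖u‖⁻¹) (γ t - p)) := by
    intro t
    exact (((integrable_indicator_iff Metric.isOpen_ball.measurableSet).2
      (integrableOn_inv_ball R)).comp_sub_left (γ t)).const_mul _
  have hdom : ∀ t ∈ Ioc 0 τ, ∀ p, ‖D f p / (γ t - p) * v t‖ ≤
      V * M * (Metric.ball (0:ℂ) R).indicator (fun u => ‖u‖⁻¹) (γ t - p) := by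
    intro t ht p
    have hV0 := hV t ⟨ht.1.le, ht.2⟩
    have hG0 := hG t ⟨ht.1.le, ht.2⟩
    by_cases hp : D f p = 0
    · rw [hp]
      simp only [zero_div, zero_mul, norm_zero]
      have : 0 ≤ V := (norm_nonneg _).trans hV0
      have : 0 ≤ (Metric.ball (0:ℂ) R).indicator (fun u => ‖u‖⁻¹) (γ t - p) :=
        indicator_nonneg (fun _ _ => by positivity) _
      positivity
    · have hp' := hRf p (subset_tsupport _ hp)
      rw [indicator_of_mem]
      · rw [norm_mul, norm_div, div_eq_mul_inv]
        have := hM p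
        calc ‖D f p‖ * ‖γ t - p‖⁻¹ * ‖v t‖ = ‖v t‖ * ‖D f p‖ * ‖γ t - p‖⁻¹ := by ring
          _ ≤ V * M * ‖γ t - p‖⁻¹ := by
            gcongr
            exact (norm_nonneg _).trans hV0
      · rw [mem_ball_zero_iff]
        have := norm_sub_le (γ t) p
        simp only [R]; linarith
  have hmeas : AEStronglyMeasurable (fun q : ℝ × ℂ => D f q.2 / (γ q.1 - q.2) * v q.1)
      ((volume.restrict (Ioc 0 τ)).prod volume) := by
    have h1 : Measurable (fun q : ℝ × ℂ => D f q.2) := (hD.comp continuous_snd).measurable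
    have h2 : Measurable (fun q : ℝ × ℂ => γ q.1 - q.2) := (by fun_prop : Continuous _).measurable
    have h3 : Measurable (fun q : ℝ × ℂ => v q.1) := (hv.comp continuous_fst).measurable
    exact ((h1.div h2).mul h3).aestronglyMeasurable
  rw [integrable_prod_iff hmeas]
  constructor
  · filter_upwards [ae_restrict_mem measurableSet_Ioc] with t ht
    refine (hdomi t).mono' ?_ (ae_of_all _ (hdom t ht))
    have h1 : Measurable (fun p : ℂ => D f p) := hD.measurable
    have h2 : Measurable (fun p : ℂ => γ t - p) := (by fun_prop : Continuous _).measurable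
    exact ((h1.div h2).mul_const _).aestronglyMeasurable
  · refine Integrable.mono' (integrable_const (V * M * ∫ u : ℂ, (Metric.ball (0:ℂ) R).indicator (fun u => ‖u‖⁻¹) u)) hmeas.norm.integral_prod_right' ?_
    filter_upwards [ae_restrict_mem measurableSet_Ioc] with t ht
    rw [Real.norm_of_nonneg (integral_nonneg fun _ => norm_nonneg _)]
    calc _ ≤ ∫ p, V * M * (Metric.ball (0:ℂ) R).indicator (fun u => ‖u‖⁻¹) (γ t - p) := by
          refine integral_mono_of_nonneg (ae_of_all _ fun _ => norm_nonneg _) (hdomi t) (ae_of_all _ (hdom t ht))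
      _ = _ := by
          rw [integral_const_mul, integral_sub_left_eq_self (fun p => (Metric.ball (0:ℂ) R).indicator (fun u => ‖u‖⁻¹) p)]

theorem area_formula {f : ℂ → ℂ} (hf : ContDiff ℝ 1 f) (hc : HasCompactSupport f)
    {γ v : ℝ → ℂ} (hγ : Continuous γ) (hv : Continuous v) {τ : ℝ} (hτ : 0 ≤ τ) :
    ∫ p, D f p * W γ v τ p = 2 * Real.pi * ∫ t in (0:ℝ)..τ, f (γ t) * v t := by
  have h1 : ∀ t, ∫ p, D f p / (γ t - p) * v t = 2 * Real.pi * (f (γ t) * v t) := by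
    intro t
    rw [integral_mul_const, pompeiu f hf hc]; ring
  have h2 : ∀ p, ∫ t in Ioc 0 τ, D f p / (γ t - p) * v t = D f p * W γ v τ p := by
    intro p
    rw [W, intervalIntegral.integral_of_le hτ, ← integral_const_mul]
    congr 1
    ext t
    ring
  rw [← intervalIntegral.integral_const_mul, intervalIntegral.integral_of_le hτ]
  simp_rw [← h1, ← h2]
  exact (integral_integral_swap (f := fun t p => D f p / (γ t - p) * v t)
    (integrable_prod_aux hf hc hγ hv τ)).symm

lemma integrable_D_mul_W {f : ℂ → ℂ} (hf : ContDiff ℝ 1 f) (hc : HasCompactSupport f)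
    {γ v : ℝ → ℂ} (hγ : Continuous γ) (hv : Continuous v) {τ : ℝ} (hτ : 0 ≤ τ) :
    Integrable (fun p => D f p * W γ v τ p) := by
  have := (integrable_prod_aux hf hc hγ hv τ).integral_prod_right
  refine this.congr (ae_of_all _ fun p => ?_)
  simp only
  rw [W, intervalIntegral.integral_of_le hτ, ← integral_const_mul]
  congr 1
  ext t
  ring


/-- A simple closed regular `C¹` curve, with velocity `v` and minimal period `τ`. -/
structure Loop (γ v : ℝ → ℂ) (τ : ℝ) : Prop where
  deriv : ∀ t, HasDerivAt γ (v t) t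
  cont : Continuous v
  pos : 0 < τ
  per : ∀ t, γ (t + τ) = γ t
  vper : ∀ t, v (t + τ) = v t
  ne : ∀ t, v t ≠ 0
  inj : ∀ s t, γ s = γ t → ∃ n : ℤ, s = t + n * τ

lemma eq_of_integral {X : Type*} [TopologicalSpace X] {S : Set X} (hS : IsPreconnected S)
    {g : X → ℂ} (hg : ContinuousOn g S) (hi : ∀ x ∈ S, ∃ n : ℤ, g x = n * (2 * Real.pi * I))
    {x y : X} (hx : x ∈ S) (hy : y ∈ S) : g x = g y := by
  wlog hlt : (g x).im ≤ (g y).im generalizing x y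
  · exact (this hy hx (le_of_not_ge hlt)).symm
  obtain ⟨n, hn⟩ := hi x hx
  obtain ⟨m, hm⟩ := hi y hy
  have him : ∀ k : ℤ, ((k : ℂ) * (2 * Real.pi * I)).im = k * (2 * Real.pi) := by
    intro k; simp
  have hpi := Real.pi_pos
  by_cases hnm : n = m
  · rw [hn, hm, hnm]
  exfalso
  rw [hn, hm, him, him] at hlt
  have h1 : n ≤ m := by
    have : (n:ℝ) ≤ m := le_of_mul_le_mul_right hlt (by positivity)
    exact_mod_cast this
  have h2 : n + 1 ≤ m := by omega
  have h3 : (n:ℝ) + 1 ≤ m := by exact_mod_cast h2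
  have hc : ContinuousOn (fun x => (g x).im) S := Complex.continuous_im.comp_continuousOn hg
  have := hS.intermediate_value hx hy hc
  have hmem : ((n:ℝ) + 1/2) * (2 * Real.pi) ∈ Icc ((g x).im) ((g y).im) := by
    rw [hn, hm, him, him]
    constructor
    · gcongr; linarith
    · gcongr; linarith
  obtain ⟨c, hcS, hcv⟩ := this hmem
  obtain ⟨k, hk⟩ := hi c hcS
  simp only [hk, him] at hcv
  have h4 : (k:ℝ) = n + 1/2 := mul_right_cancel₀ (by positivity) hcv
  have h5 : (2 * k : ℝ) = 2 * n + 1 := by linarith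
  have h6 : 2 * k = 2 * n + 1 := by exact_mod_cast h5
  omega

namespace Loop

variable {γ v : ℝ → ℂ} {τ : ℝ}

lemma cγ (h : Loop γ v τ) : Continuous γ :=
  continuous_iff_continuousAt.2 fun t => (h.deriv t).continuousAt

lemma exp_log (h : Loop γ v τ) {p : ℂ} (hp : p ∉ range γ) (t : ℝ) :
    exp (∫ s in (0:ℝ)..t, v s / (γ s - p)) * (γ 0 - p) = γ t - p := by
  have hne : ∀ t, γ t - p ≠ 0 := fun t h0 => hp ⟨t, sub_eq_zero.1 h0⟩
  have hcont : Continuous (fun s => v s / (γ s - p)) :=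
    h.cont.div (h.cγ.sub continuous_const) hne
  set L : ℝ → ℂ := fun t => ∫ s in (0:ℝ)..t, v s / (γ s - p) with hL
  have hLd : ∀ t, HasDerivAt L (v t / (γ t - p)) t := fun t =>
    intervalIntegral.integral_hasDerivAt_right (hcont.intervalIntegrable _ _)
      (hcont.stronglyMeasurableAtFilter _ _) hcont.continuousAt
  have hd : ∀ t, HasDerivAt (fun t => exp (-L t) * (γ t - p)) 0 t := by
    intro t
    have := (hLd t).neg.cexp.mul ((h.deriv t).sub_const p)
    refine this.congr_deriv ?_
    have := hne t
    simp only [Pi.neg_apply]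
    field_simp
    ring
  have hconst := is_const_of_deriv_eq_zero (fun t => (hd t).differentiableAt)
    (fun t => (hd t).deriv) t 0
  have hL0 : L 0 = 0 := by simp [hL]
  simp only [hL0, neg_zero, exp_zero, one_mul] at hconst
  rw [← hconst, ← mul_assoc, ← exp_add, add_neg_cancel, exp_zero, one_mul]

lemma W_int (h : Loop γ v τ) {p : ℂ} (hp : p ∉ range γ) :
    ∃ n : ℤ, W γ v τ p = n * (2 * Real.pi * I) := by
  have h1 := h.exp_log hp τ
  have h2 : γ τ = γ 0 := by simpa using h.per 0
  have hne : γ 0 - p ≠ 0 := fun h0 => hp ⟨0, sub_eq_zero.1 h0⟩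
  rw [h2, mul_eq_right₀ hne, exp_eq_one_iff] at h1
  exact h1

lemma W_zero_of_log (h : Loop γ v τ) {p : ℂ} (g : ℝ → ℂ) (hg : Continuous g)
    (hexp : ∀ t, exp (g t) = γ t - p) (hper : g τ = g 0) : W γ v τ p = 0 := by
  have hne : ∀ t, γ t - p ≠ 0 := fun t => by rw [← hexp]; exact exp_ne_zero _
  have hp : p ∉ range γ := by
    rintro ⟨t, rfl⟩; exact hne t (sub_self _)
  have hcont : Continuous (fun s => v s / (γ s - p)) :=
    h.cont.div (h.cγ.sub continuous_const) hne
  have hLc : Continuous (fun t => ∫ s in (0:ℝ)..t, v s / (γ s - p)) :=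
    intervalIntegral.continuous_primitive (fun a b => hcont.intervalIntegrable a b) 0
  have key := eq_of_integral (S := (univ : Set ℝ)) isPreconnected_univ
    (g := fun t => (∫ s in (0:ℝ)..t, v s / (γ s - p)) - (g t - g 0)) (by fun_prop) (by
      intro t _
      rw [← exp_eq_one_iff, exp_sub, exp_sub, hexp, hexp, ← h.exp_log hp t]
      have := hne 0
      have := exp_ne_zero (∫ s in (0:ℝ)..t, v s / (γ s - p))
      field_simp) (mem_univ τ) (mem_univ 0)
  simpa [W, hper] using key

lemma W_cont (h : Loop γ v τ) : ContinuousOn (W γ v τ) (range γ)ᶜ := by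
  rw [continuousOn_iff_continuous_domRestrict]
  have := h.cγ
  have := h.cont
  refine intervalIntegral.continuous_parametric_intervalIntegral_of_continuous' 
    (f := fun (p : ((range γ)ᶜ : Set ℂ)) t => v t / (γ t - p)) ?_ 0 τ
  refine Continuous.div (by fun_prop) (by fun_prop) ?_
  rintro ⟨⟨p, hp⟩, t⟩ h0
  exact hp ⟨t, sub_eq_zero.1 h0⟩

lemma W_const (h : Loop γ v τ) {S : Set ℂ} (hS : IsPreconnected S) (hSγ : S ⊆ (range γ)ᶜ)
    {x y : ℂ} (hx : x ∈ S) (hy : y ∈ S) : W γ v τ x = W γ v τ y :=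
  eq_of_integral hS (h.W_cont.mono hSγ) (fun _ hx => h.W_int (hSγ hx)) hx hy

lemma γ_int (h : Loop γ v τ) (t : ℝ) (n : ℤ) : γ (t + n * τ) = γ t := by
  have : Function.Periodic γ τ := h.per
  exact this.int_mul n t

lemma v_int (h : Loop γ v τ) (t : ℝ) (n : ℤ) : v (t + n * τ) = v t := by
  have : Function.Periodic v τ := h.vper
  exact this.int_mul n t

lemma range_eq (h : Loop γ v τ) : range γ = γ '' Icc 0 τ := by
  have : Function.Periodic γ τ := h.per
  have h2 := this.image_Icc h.pos 0
  rw [zero_add] at h2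
  exact h2.symm

lemma compact_range (h : Loop γ v τ) : IsCompact (range γ) := by
  rw [h.range_eq]
  exact isCompact_Icc.image h.cγ

lemma W_far (h : Loop γ v τ) : ∃ R, ∀ p, R ≤ ‖p‖ → p ∉ range γ ∧ W γ v τ p = 0 := by
  obtain ⟨G, hG⟩ := h.compact_range.isBounded.exists_norm_le
  obtain ⟨V, hV⟩ := (isCompact_Icc (a := (0:ℝ)) (b := τ)).exists_bound_of_continuousOn
    h.cont.continuousOn
  have hV0 : 0 ≤ V := (norm_nonneg _).trans (hV 0 ⟨le_rfl, h.pos.le⟩)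
  have hτ := h.pos
  refine ⟨G + 1 + τ * V, fun p hp => ?_⟩
  have hVτ : 0 ≤ τ * V := by positivity
  have hpr : p ∉ range γ := fun hr => by
    have := hG p hr
    linarith
  refine ⟨hpr, ?_⟩
  have hbound : ‖W γ v τ p‖ ≤ (V / (1 + τ * V)) * |τ - 0| := by
    refine intervalIntegral.norm_integral_le_of_norm_le_const ?_
    intro t ht
    rw [uIoc_of_le hτ.le] at ht
    have h1 := hV t ⟨ht.1.le, ht.2⟩
    have h2 := hG _ (mem_range_self t)
    have h3 : 1 + τ * V ≤ ‖γ t - p‖ := by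
      have := norm_sub_norm_le p (γ t)
      rw [norm_sub_rev] at this
      linarith
    rw [norm_div]
    gcongr
  obtain ⟨n, hn⟩ := h.W_int hpr
  by_cases hn0 : n = 0
  · simp [hn, hn0]
  exfalso
  have h1 : (1:ℝ) ≤ |(n:ℝ)| := by
    have := Int.one_le_abs hn0
    exact_mod_cast this
  have h2 : ‖W γ v τ p‖ = |(n:ℝ)| * (2 * Real.pi) := by
    rw [hn]
    simp [abs_of_pos Real.pi_pos]
  have h3 : (V / (1 + τ * V)) * |τ - 0| ≤ 1 := by
    rw [sub_zero, abs_of_pos hτ, div_mul_eq_mul_div, div_le_one (by positivity)]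
    linarith
  have := Real.pi_gt_three
  nlinarith

lemma collar (h : Loop γ v τ) : ∃ δ > 0, ∀ t ε : ℝ, 0 < |ε| → |ε| < δ →
    γ t + ε * (I * v t) ∉ range γ := by
  have hτ := h.pos
  have cg := h.cγ
  have cv := h.cont
  set K := Icc (-τ) (2 * τ) with hK
  have hKc : IsCompact K := isCompact_Icc
  have hKne : K.Nonempty := ⟨0, by constructor <;> linarith⟩
  obtain ⟨t0, ht0, hmin⟩ := hKc.exists_isMinOn hKne h.cont.norm.continuousOn
  set m := ‖v t0‖ with hm
  have hm0 : 0 < m := norm_pos_iff.2 (h.ne t0)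
  obtain ⟨V, hV⟩ := hKc.exists_bound_of_continuousOn h.cont.continuousOn
  have hV0 : 0 ≤ V := (norm_nonneg _).trans (hV t0 ht0)
  obtain ⟨η, hη, hu⟩ := Metric.uniformContinuousOn_iff.1
    (hKc.uniformContinuousOn_of_continuous h.cont.continuousOn) m hm0
  -- far pairs
  obtain ⟨c, hc, hfar⟩ : ∃ c > 0, ∀ t ∈ Icc 0 τ, ∀ s ∈ K, η ≤ |s - t| → |s - t| ≤ τ / 2 →
      c ≤ ‖γ s - γ t‖ := by
    set S : Set (ℝ × ℝ) := (Icc 0 τ ×ˢ K) ∩ {q | η ≤ |q.2 - q.1| ∧ |q.2 - q.1| ≤ τ / 2} with hS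
    have hSc : IsCompact S := by
      refine (isCompact_Icc.prod hKc).inter_right ?_
      have c1 : IsClosed {q : ℝ × ℝ | η ≤ |q.2 - q.1|} := isClosed_le (by fun_prop) (by fun_prop)
      have c2 : IsClosed {q : ℝ × ℝ | |q.2 - q.1| ≤ τ / 2} :=
        isClosed_le (by fun_prop) (by fun_prop)
      exact c1.inter c2
    rcases S.eq_empty_or_nonempty with he | hne
    · refine ⟨1, one_pos, fun t ht s hs h1 h2 => ?_⟩
      have : (t, s) ∈ S := ⟨⟨ht, hs⟩, h1, h2⟩
      rw [he] at this
      exact this.elim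
    · obtain ⟨⟨t1, s1⟩, hq, hqm⟩ := hSc.exists_isMinOn hne
        (f := fun q : ℝ × ℝ => ‖γ q.2 - γ q.1‖) (by fun_prop)
      refine ⟨‖γ s1 - γ t1‖, ?_, fun t ht s hs h1 h2 =>
        hqm (show (t, s) ∈ S from ⟨⟨ht, hs⟩, h1, h2⟩)⟩
      rw [gt_iff_lt, norm_pos_iff]
      intro h0
      obtain ⟨n, hn⟩ := h.inj _ _ (sub_eq_zero.1 h0)
      obtain ⟨_, h1, h2⟩ := hq
      simp only at h1 h2
      rw [hn, add_sub_cancel_left, abs_mul, abs_of_pos hτ] at h1 h2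
      have h3 : |(n:ℝ)| < 1 := by
        by_contra hh
        push Not at hh
        nlinarith
      have h4 : n = 0 := by
        rw [← Int.abs_lt_one_iff]
        exact_mod_cast h3
      rw [h4] at h1
      simp at h1
      linarith
  refine ⟨c / (V + 1), by positivity, ?_⟩
  intro t' ε hε0 hεδ hmem
  -- reduce to `t ∈ [0, τ]`
  obtain ⟨t, ht, htγ, htv⟩ : ∃ t ∈ Icc 0 τ, γ t' = γ t ∧ v t' = v t := by
    obtain ⟨n, hn, -⟩ := existsUnique_add_zsmul_mem_Ico hτ t' 0
    simp only [zsmul_eq_mul, zero_add] at hn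
    exact ⟨t' + n * τ, ⟨hn.1, hn.2.le⟩, (h.γ_int _ _).symm, (h.v_int _ _).symm⟩
  rw [htγ, htv] at hmem
  obtain ⟨s', hs'⟩ := hmem
  obtain ⟨s, hs, hsγ⟩ : ∃ s, |s - t| ≤ τ / 2 ∧ γ s = γ t + ε * (I * v t) := by
    obtain ⟨n, hn, -⟩ := existsUnique_add_zsmul_mem_Ico hτ s' (t - τ / 2)
    simp only [zsmul_eq_mul] at hn
    refine ⟨s' + n * τ, ?_, by rw [h.γ_int, hs']⟩
    rw [abs_le]
    constructor <;> linarith [hn.1, hn.2]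
  have hsK : s ∈ K := by
    rw [abs_le] at hs
    constructor <;> linarith [ht.1, ht.2]
  have htK : t ∈ K := ⟨by linarith [ht.1], by linarith [ht.2]⟩
  have hst : s ≠ t := by
    rintro rfl
    have h1 : (ε:ℂ) * (I * v s) = 0 := by
      have := hsγ
      exact left_eq_add.1 this
    have h2 : (ε:ℂ) ≠ 0 := by
      intro h0
      have : ε = 0 := by exact_mod_cast h0
      rw [this] at hε0; simp at hε0
    exact mul_ne_zero h2 (mul_ne_zero I_ne_zero (h.ne s)) h1
  by_cases hnear : η ≤ |s - t|
  · have h1 := hfar t ht s hsK hnear hs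
    rw [hsγ, add_sub_cancel_left] at h1
    have h2 : ‖(ε:ℂ) * (I * v t)‖ = |ε| * ‖v t‖ := by simp
    rw [h2] at h1
    rw [lt_div_iff₀ (by positivity)] at hεδ
    have := hV t htK
    have : |ε| * ‖v t‖ ≤ |ε| * (V + 1) := by gcongr; linarith
    linarith
  · push Not at hnear
    -- Rolle
    set F : ℝ → ℝ := fun r => ((starRingEnd ℂ (v t)) * γ r).re with hF
    have hFd : ∀ r, HasDerivAt F ((starRingEnd ℂ (v t)) * v r).re r := by
      intro r
      exact (Complex.reCLM.hasFDerivAt.comp_hasDerivAt r ((h.deriv r).const_mul (starRingEnd ℂ (v t))))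
    have hFeq : F s = F t := by
      simp only [hF, hsγ]
      simp
      ring
    obtain ⟨r, hr1, hr2⟩ : ∃ r, |r - t| ≤ |s - t| ∧ ((starRingEnd ℂ (v t)) * v r).re = 0 := by
      rcases lt_or_gt_of_ne hst with hlt | hlt
      · obtain ⟨r, hr, hr0⟩ := exists_hasDerivAt_eq_zero hlt
          (fun x _ => (hFd x).continuousAt.continuousWithinAt) hFeq (fun x _ => hFd x)
        refine ⟨r, ?_, hr0⟩
        rw [abs_of_neg (by linarith [hr.2]), abs_of_neg (by linarith)]
        linarith [hr.1]
      · obtain ⟨r, hr, hr0⟩ := exists_hasDerivAt_eq_zero hlt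
          (fun x _ => (hFd x).continuousAt.continuousWithinAt) hFeq.symm (fun x _ => hFd x)
        refine ⟨r, ?_, hr0⟩
        rw [abs_of_pos (by linarith [hr.1]), abs_of_pos (by linarith)]
        linarith [hr.2]
    have hrK : r ∈ K := by
      have := hr1.trans hs
      rw [abs_le] at this
      constructor <;> linarith [ht.1, ht.2]
    have h1 := hu r hrK t htK (by rw [Real.dist_eq]; linarith)
    rw [dist_eq_norm] at h1
    have h2 : m ≤ ‖v t‖ := hmin htK
    have h3 : ((starRingEnd ℂ (v t)) * v r).re =
        ‖v t‖ ^ 2 + ((starRingEnd ℂ (v t)) * (v r - v t)).re := by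
      rw [Complex.sq_norm, Complex.normSq_apply]
      simp
      ring
    have h4 : |((starRingEnd ℂ (v t)) * (v r - v t)).re| ≤ ‖v t‖ * ‖v r - v t‖ := by
      refine (Complex.abs_re_le_norm _).trans ?_
      rw [norm_mul, RCLike.norm_conj]
    rw [abs_le] at h4
    rw [h3] at hr2
    have : ‖v t‖ * ‖v r - v t‖ < ‖v t‖ * ‖v t‖ := by
      apply mul_lt_mul_of_pos_left (by linarith) (by linarith)
    nlinarith [h4.1]

lemma two_values (h : Loop γ v τ) : ∃ m : ℤ, ∀ p ∉ range γ,
    W γ v τ p = 0 ∨ W γ v τ p = m * (2 * Real.pi * I) := by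
  obtain ⟨δ, hδ, hcol⟩ := h.collar
  have cg := h.cγ
  have cv := h.cont
  have side : ∀ a b : ℝ, (∀ ε ∈ Ioo a b, 0 < |ε| ∧ |ε| < δ) →
      ∀ t t' : ℝ, ∀ ε ∈ Ioo a b, ∀ ε' ∈ Ioo a b,
      W γ v τ (γ t + ε * (I * v t)) = W γ v τ (γ t' + ε' * (I * v t')) := by
    intro a b hab t t' ε hε ε' hε'
    have hpre : IsPreconnected ((fun q : ℝ × ℝ => γ q.1 + q.2 * (I * v q.1)) ''
        (univ ×ˢ Ioo a b)) :=
      (isPreconnected_univ.prod isPreconnected_Ioo).image _ (by fun_prop)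
    refine h.W_const hpre ?_ ⟨(t, ε), ⟨mem_univ _, hε⟩, rfl⟩ ⟨(t', ε'), ⟨mem_univ _, hε'⟩, rfl⟩
    rintro _ ⟨⟨x, y⟩, ⟨_, hy⟩, rfl⟩
    exact hcol x y (hab y hy).1 (hab y hy).2
  have sp := side 0 δ (fun ε hε => by rw [abs_of_pos hε.1]; exact hε)
  have sm := side (-δ) 0 (fun ε hε => by
    rw [abs_of_neg hε.2]; exact ⟨by linarith [hε.2], by linarith [hε.1]⟩)
  set l := W γ v τ (γ 0 + ((δ/2 : ℝ) : ℂ) * (I * v 0)) with hl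
  set r := W γ v τ (γ 0 + ((-(δ/2) : ℝ) : ℂ) * (I * v 0)) with hr
  have hlr : ∀ p ∉ range γ, W γ v τ p = l ∨ W γ v τ p = r := by
    intro p hp
    obtain ⟨q, ⟨t, rfl⟩, hq⟩ := h.compact_range.exists_isMinOn (range_nonempty γ)
      (f := fun q => ‖q - p‖) (by fun_prop)
    have hmin : ∀ s, ‖γ t - p‖ ≤ ‖γ s - p‖ := fun s => hq (mem_range_self s)
    have hpos : 0 < ‖γ t - p‖ := norm_pos_iff.2 fun h0 => hp ⟨t, sub_eq_zero.1 h0⟩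
    -- orthogonality
    have horth : ((starRingEnd ℂ (v t)) * (p - γ t)).re = 0 := by
      have hd : HasDerivAt (fun s => ‖γ s - p‖ ^ 2) (2 * inner ℝ (γ t - p) (v t)) t :=
        ((h.deriv t).sub_const p).norm_sq
      have hloc : IsLocalMin (fun s => ‖γ s - p‖ ^ 2) t := by
        refine Filter.Eventually.of_forall fun s => ?_
        have := hmin s
        simp only
        gcongr
      have := hloc.hasDerivAt_eq_zero hd
      rw [Complex.inner] at this
      simp at this ⊢
      linarith
    -- p - γ t = a * (I * v t)
    obtain ⟨a, ha⟩ : ∃ a : ℝ, p - γ t = a * (I * v t) := by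
      refine ⟨((starRingEnd ℂ (v t)) * (p - γ t)).im / ‖v t‖ ^ 2, ?_⟩
      have hv := h.ne t
      have hn : (‖v t‖ : ℂ) ≠ 0 := by exact_mod_cast (norm_ne_zero_iff.2 hv)
      have e1 : (starRingEnd ℂ (v t)) * (p - γ t) =
          (((starRingEnd ℂ (v t)) * (p - γ t)).im : ℂ) * I := by
        apply Complex.ext
        · rw [horth]; simp
        · simp
      have e2 : v t * starRingEnd ℂ (v t) = (‖v t‖ : ℂ) ^ 2 := Complex.mul_conj' _
      push_cast
      rw [div_mul_eq_mul_div, eq_div_iff (pow_ne_zero 2 hn), ← e2]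
      calc (p - γ t) * (v t * starRingEnd ℂ (v t)) = v t * (starRingEnd ℂ (v t) * (p - γ t)) := by ring
        _ = _ := by rw [e1]; simp; ring
    have ha0 : a ≠ 0 := by
      rintro rfl
      rw [norm_sub_rev, ha] at hpos
      simp at hpos
    -- segment
    have hseg : ∀ σ ∈ Ioc (0:ℝ) 1, W γ v τ (γ t + ((σ * a : ℝ) : ℂ) * (I * v t)) = W γ v τ p := by
      intro σ hσ
      have hpre : IsPreconnected ((fun x : ℝ => γ t + ((x * a : ℝ) : ℂ) * (I * v t)) '' Ioc 0 1) :=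
        isPreconnected_Ioc.image _ (by fun_prop)
      refine h.W_const hpre ?_ ⟨σ, hσ, rfl⟩ ⟨1, ⟨one_pos, le_rfl⟩, ?_⟩
      · rintro _ ⟨x, hx, rfl⟩ ⟨s, hs⟩
        have h1 := hmin s
        simp only at hs
        have e : γ s - p = (1 - x : ℝ) * (γ t - p) := by
          rw [hs]
          have : γ t - p = -(a * (I * v t)) := by rw [← ha]; ring
          rw [this]
          have hp2 : p = γ t + a * (I * v t) := by rw [← ha]; ring
          rw [hp2]; push_cast; ring
        rw [e, norm_mul, Complex.norm_real, Real.norm_of_nonneg (by linarith [hx.2])] at h1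
        nlinarith [hx.1]
      · simp only [one_mul]
        rw [← ha]; ring
    obtain ⟨σ, hσ, hσ2⟩ : ∃ σ ∈ Ioc (0:ℝ) 1, σ * |a| < δ := by
      have hap : 0 < |a| := abs_pos.2 ha0
      refine ⟨min 1 (δ / (2 * |a|)), ⟨by positivity, min_le_left _ _⟩, ?_⟩
      calc min 1 (δ / (2 * |a|)) * |a| ≤ δ / (2 * |a|) * |a| := by
            gcongr; exact min_le_right _ _
        _ = δ / 2 := by field_simp
        _ < δ := by linarith
    rw [← hseg σ hσ]
    rcases lt_or_gt_of_ne ha0 with hneg | hpos'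
    · right
      rw [abs_of_neg hneg] at hσ2
      exact sm t 0 _ ⟨by linarith, mul_neg_of_pos_of_neg hσ.1 hneg⟩ _ ⟨by linarith, by linarith⟩
    · left
      rw [abs_of_pos hpos'] at hσ2
      exact sp t 0 _ ⟨mul_pos hσ.1 hpos', hσ2⟩ _ ⟨by linarith, by linarith⟩
  obtain ⟨R, hR⟩ := h.W_far
  obtain ⟨hq, hq0⟩ := hR ((|R| : ℝ) : ℂ) (by simp [le_abs_self])
  have hli : ∃ n : ℤ, l = n * (2 * Real.pi * I) := h.W_int (hcol _ _ (by positivity) (by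
    rw [abs_of_pos (by positivity)]; linarith))
  have hri : ∃ n : ℤ, r = n * (2 * Real.pi * I) := h.W_int (hcol _ _ (by
    rw [abs_neg]; positivity) (by rw [abs_neg, abs_of_pos (by positivity)]; linarith))
  obtain ⟨nl, hnl⟩ := hli
  obtain ⟨nr, hnr⟩ := hri
  rcases hlr _ hq with h0 | h0
  · refine ⟨nr, fun p hp => ?_⟩
    rw [← hnr]
    rcases hlr p hp with h1 | h1
    · left; rw [h1, ← h0, hq0]
    · right; exact h1
  · refine ⟨nl, fun p hp => ?_⟩
    rw [← hnl]
    rcases hlr p hp with h1 | h1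
    · right; exact h1
    · left; rw [h1, ← h0, hq0]

lemma range_null (h : Loop γ v τ) : volume (range γ) = 0 := by
  have h1 : range γ = (fun z : ℂ => γ z.re) '' univ := by
    rw [image_univ]
    ext x
    constructor
    · rintro ⟨t, rfl⟩; exact ⟨(t : ℂ), by simp⟩
    · rintro ⟨z, rfl⟩; exact ⟨z.re, rfl⟩
  rw [h1]
  refine addHaar_image_eq_zero_of_det_fderivWithin_eq_zero volume
    (f' := fun z => (ContinuousLinearMap.toSpanSingleton ℝ (v z.re)).comp reCLM) ?_ ?_
  · intro z _
    exact ((h.deriv z.re).hasFDerivAt.comp z reCLM.hasFDerivAt).hasFDerivWithinAt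
  · intro z _
    by_contra hne
    have hinj : Function.Injective
        ((ContinuousLinearMap.toSpanSingleton ℝ (v z.re)).comp reCLM) := by
      have := LinearMap.equivOfDetNeZero _ hne
      exact (LinearMap.equivOfDetNeZero _ hne).injective
    have : (I : ℂ) = 0 := hinj (by simp)
    exact I_ne_zero this

end Loop


lemma ode_unique {β : ℝ × ℝ → ℝ × ℝ} (hβ : ContDiff ℝ 1 β) {f g : ℝ → ℝ × ℝ}
    (hf : ∀ t, HasDerivAt f (β (f t)) t) (hg : ∀ t, HasDerivAt g (β (g t)) t)
    {R : ℝ} (hfR : ∀ t, ‖f t‖ ≤ R) (hgR : ∀ t, ‖g t‖ ≤ R) {t₀ : ℝ} (h0 : f t₀ = g t₀) (t : ℝ) :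
    f t = g t := by
  obtain ⟨K, hK⟩ := hβ.contDiffOn.exists_lipschitzOnWith (by norm_num)
    (convex_closedBall (0 : ℝ × ℝ) R) (isCompact_closedBall _ _)
  refine ODE_solution_unique_of_mem_Ioo (v := fun _ => β) (s := fun _ => Metric.closedBall 0 R)
    (a := min t t₀ - 1) (b := max t t₀ + 1) (fun _ _ => hK) (t₀ := t₀)
    ⟨by linarith [min_le_right t t₀], by linarith [le_max_right t t₀]⟩
    (fun s _ => ⟨hf s, by simpa using hfR s⟩) (fun s _ => ⟨hg s, by simpa using hgR s⟩) h0
    ⟨by linarith [min_le_left t t₀], by linarith [le_max_left t t₀]⟩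

lemma exists_loop {β : ℝ × ℝ → ℝ × ℝ} (hβ : ContDiff ℝ 1 β) {lam : ℝ → ℝ × ℝ} {T : ℝ} (hT : 0 < T)
    (hd : ∀ t, HasDerivAt lam (β (lam t)) t) (hper : ∀ t, lam (t + T) = lam t)
    (hnc : ∃ t₁ t₂, lam t₁ ≠ lam t₂) :
    ∃ τ : ℝ, (∀ t, lam (t + τ) = lam t) ∧ 
      Loop (fun t => equivRealProdCLM.symm (lam t)) (fun t => equivRealProdCLM.symm (β (lam t))) τ := by
  have hc : Continuous lam := continuous_iff_continuousAt.2 fun t => (hd t).continuousAt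
  obtain ⟨R, hR⟩ : ∃ R, ∀ t, ‖lam t‖ ≤ R := by
    have hp : Function.Periodic lam T := hper
    have hcomp : IsCompact (range lam) := by
      rw [← hp.image_Icc hT 0]
      exact isCompact_Icc.image hc
    obtain ⟨R, hR⟩ := hcomp.isBounded.exists_norm_le
    exact ⟨R, fun t => hR _ (mem_range_self t)⟩
  have hshift : ∀ s t, lam s = lam t → ∀ x, lam (x + (s - t)) = lam x := by
    intro s t hst x
    refine ode_unique hβ (f := fun x => lam (x + (s - t))) (g := lam) (fun y => ?_) hd
      (fun y => hR _) hR (t₀ := t) (by simpa using hst) x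
    exact (hd (y + (s - t))).comp_add_const y (s - t)
  have hne : ∀ t, β (lam t) ≠ 0 := by
    intro t h0
    have hconst : ∀ x, lam x = lam t := by
      intro x
      refine ode_unique hβ (f := lam) (g := fun _ => lam t) hd (fun y => ?_) hR
        (fun _ => hR t) (t₀ := t) rfl x
      simp only [h0]
      exact hasDerivAt_const y _
    obtain ⟨t₁, t₂, h12⟩ := hnc
    exact h12 ((hconst t₁).trans (hconst t₂).symm)
  let S : AddSubgroup ℝ :=
    { carrier := {c | ∀ x, lam (x + c) = lam x}
      zero_mem' := fun x => by simp
      add_mem' := fun {a b} ha hb x => by rw [← add_assoc, hb, ha]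
      neg_mem' := fun {a} ha x => by
        have := ha (x + -a)
        rw [← this]; simp }
  have hS : ∀ c, c ∈ S ↔ ∀ x, lam (x + c) = lam x := fun c => Iff.rfl
  have hTS : T ∈ S := hper
  obtain ⟨a, ha⟩ : ∃ a, S = AddSubgroup.closure {a} := by
    rcases S.dense_or_cyclic with hdense | h
    · exfalso
      have : ∀ c, lam c = lam 0 := by
        have hcl : IsClosed {c | lam c = lam 0} := isClosed_eq hc continuous_const
        have hsub : (S : Set ℝ) ⊆ {c | lam c = lam 0} := fun c hcS => by
          have := (hS c).1 hcS 0
          simpa using this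
        intro c
        exact (hcl.closure_subset_iff.2 hsub) (hdense c)
      obtain ⟨t₁, t₂, h12⟩ := hnc
      exact h12 ((this t₁).trans (this t₂).symm)
    · exact h
  have hmem : ∀ c, c ∈ S ↔ ∃ n : ℤ, n • a = c := by
    intro c
    rw [ha, AddSubgroup.mem_closure_singleton]
  have ha0 : a ≠ 0 := by
    rintro rfl
    obtain ⟨n, hn⟩ := (hmem T).1 hTS
    simp at hn
    linarith
  have haS : a ∈ S := (hmem a).2 ⟨1, by simp⟩
  have habs : |a| ∈ S := by
    rcases abs_choice a with h | h <;> rw [h]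
    · exact haS
    · exact S.neg_mem haS
  refine ⟨|a|, (hS _).1 habs, ?_⟩
  refine ⟨fun t => ?_, ?_, abs_pos.2 ha0, ?_, ?_, ?_, ?_⟩
  · exact (equivRealProdCLM.symm : ℝ × ℝ →L[ℝ] ℂ).hasFDerivAt.comp_hasDerivAt t (hd t)
  · exact equivRealProdCLM.symm.continuous.comp (hβ.continuous.comp hc)
  · intro t; simp only [(hS _).1 habs]
  · intro t; simp only [(hS _).1 habs]
  · intro t h0
    exact hne t (by simpa using h0)
  · intro s t hst
    have hst' : lam s = lam t := equivRealProdCLM.symm.injective hst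
    obtain ⟨n, hn⟩ := (hmem _).1 ((hS _).2 (hshift s t hst'))
    rcases abs_choice a with h | h
    · refine ⟨n, ?_⟩
      rw [h]; simp at hn; linarith
    · refine ⟨-n, ?_⟩
      rw [h]; simp at hn; push_cast; linarith

lemma Loop.formula {γ v : ℝ → ℂ} {τ : ℝ} (h : Loop γ v τ) {f : ℂ → ℂ} (hf : ContDiff ℝ 1 f) :
    Integrable (fun p => D f p * W γ v τ p) ∧
    ∫ p, D f p * W γ v τ p = 2 * Real.pi * ∫ t in (0:ℝ)..τ, f (γ t) * v t := by
  obtain ⟨R, hR⟩ := h.W_far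
  have hR' : ∀ t, ‖γ t‖ < R := fun t => by
    by_contra hh
    push Not at hh
    exact (hR _ hh).1 (mem_range_self t)
  have hRpos : 0 < R := (norm_nonneg _).trans_lt (hR' 0)
  let χ : ContDiffBump (0 : ℂ) := ⟨R, R + 1, hRpos, by linarith⟩
  set g : ℂ → ℂ := fun z => (χ z : ℝ) • f z with hg
  have hgf : ∀ p, ‖p‖ < R → g =ᶠ[𝓝 p] f := by
    intro p hp
    have : Metric.ball (0:ℂ) R ∈ 𝓝 p := Metric.isOpen_ball.mem_nhds (by simpa using hp)
    filter_upwards [this] with z hz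
    have : χ z = 1 := χ.one_of_mem_closedBall (Metric.ball_subset_closedBall hz)
    simp [hg, this]
  have hgc : ContDiff ℝ 1 g := χ.contDiff.smul hf
  have hgs : HasCompactSupport g := χ.hasCompactSupport.smul_right
  have e1 : (fun p => D g p * W γ v τ p) = fun p => D f p * W γ v τ p := by
    ext p
    by_cases hp : ‖p‖ < R
    · simp only [D, (hgf p hp).fderiv_eq]
    · push Not at hp
      simp [(hR p hp).2]
  have e2 : ∀ t, g (γ t) = f (γ t) := fun t => (hgf _ (hR' t)).eq_of_nhds
  have i1 := integrable_D_mul_W hgc hgs h.cγ h.cont h.pos.le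
  have i2 := area_formula hgc hgs h.cγ h.cont h.pos.le
  rw [e1] at i1
  rw [show (∫ p, D g p * W γ v τ p) = ∫ p, D f p * W γ v τ p from by rw [e1]] at i2
  simp only [e2] at i2
  exact ⟨i1, i2⟩

end BD

open BD in
theorem bendixson_dulac
    (U : Set (ℝ × ℝ)) (hUopen : IsOpen U) (hUsc : SimplyConnectedSpace U)
    (β : ℝ × ℝ → ℝ × ℝ) (hβ : ContDiff ℝ 1 β)
    (φ : ℝ × ℝ → ℝ) (hφ : ContDiff ℝ 1 φ)
    (hdiv : ∀ p ∈ U,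
      0 < fderiv ℝ (fun q => φ q * (β q).1) p (1, 0) +
          fderiv ℝ (fun q => φ q * (β q).2) p (0, 1)) :
    ¬∃ (lam : ℝ → ℝ × ℝ) (T : ℝ), 0 < T ∧
      (∀ t, HasDerivAt lam (β (lam t)) t) ∧
      (∀ t, lam (t + T) = lam t) ∧
      (∃ t₁ t₂, lam t₁ ≠ lam t₂) ∧
      (∀ t, lam t ∈ U) := by
  rintro ⟨lam, T, hT, hd, hper, hnc, hU⟩
  obtain ⟨τ, hτper, h⟩ := exists_loop hβ hT hd hper hnc
  set e : ℂ ≃L[ℝ] ℝ × ℝ := equivRealProdCLM with he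
  set γ : ℝ → ℂ := fun t => e.symm (lam t) with hγ
  set v : ℝ → ℂ := fun t => e.symm (β (lam t)) with hv
  have hlamc : Continuous lam := continuous_iff_continuousAt.2 fun t => (hd t).continuousAt
  -- winding number vanishes outside `U`
  have hout : ∀ p, e p ∉ U → W γ v τ p = 0 := by
    intro p hp
    have hUs : IsSimplyConnected U := hUsc
    obtain ⟨g, hgc, hge⟩ := exists_continuousOn_eqOn_exp_comp hUs hUopen
      (g := fun x => e.symm x - p) (by fun_prop) (by
        rintro ⟨x, hx, hx0⟩
        apply hp
        have : e.symm x = p := sub_eq_zero.1 hx0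
        rw [← this]; simpa using hx)
    refine h.W_zero_of_log (fun t => g (lam t)) (hgc.comp_continuous hlamc hU)
      (fun t => hge (hU t)) ?_
    have := hτper 0
    rw [zero_add] at this
    simp only [this]
  obtain ⟨m, hm⟩ := h.two_values
  have hnull : ∀ᵐ p : ℂ, p ∉ range γ := by
    exact measure_eq_zero_iff_ae_notMem.1 h.range_null
  set f1 : ℂ → ℂ := fun z => starRingEnd ℂ (e.symm (β (e z))) with hf1
  set f2 : ℂ → ℂ := fun z => (φ (e z) : ℝ) • f1 z with hf2
  have hf1c : ContDiff ℝ 1 f1 :=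
    conjCLE.contDiff.comp (e.symm.contDiff.comp (hβ.comp e.contDiff))
  have hf2c : ContDiff ℝ 1 f2 := (hφ.comp e.contDiff).smul hf1c
  have hf1v : ∀ t, f1 (γ t) * v t = ((‖v t‖ ^ 2 : ℝ) : ℂ) := by
    intro t
    simp only [hf1, hγ, hv, e.apply_symm_apply]
    rw [Complex.conj_mul']
    push_cast
    rfl
  have hf2v : ∀ t, f2 (γ t) * v t = ((φ (lam t) * ‖v t‖ ^ 2 : ℝ) : ℂ) := by
    intro t
    have := hf1v t
    simp only [hf2, real_smul, mul_assoc, this]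
    simp [hγ]
  have hD : ∀ p, (D f2 p).re = fderiv ℝ (fun q => φ q * (β q).1) (e p) (1, 0) +
          fderiv ℝ (fun q => φ q * (β q).2) (e p) (0, 1) := by
    intro p
    have c1 : DifferentiableAt ℝ (fun q => φ q * (β q).1) (e p) :=
      (hφ.mul (contDiff_fst.comp hβ)).differentiable (by norm_num) _
    have c2 : DifferentiableAt ℝ (fun q => φ q * (β q).2) (e p) :=
      (hφ.mul (contDiff_snd.comp hβ)).differentiable (by norm_num) _
    have d1 := ofRealCLM.hasFDerivAt.comp p (c1.hasFDerivAt.comp p e.hasFDerivAt)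
    have d2 := ofRealCLM.hasFDerivAt.comp p (c2.hasFDerivAt.comp p e.hasFDerivAt)
    have d3 := d1.sub (d2.mul_const I)
    have hev : f2 = fun z => ((φ (e z) * (β (e z)).1 : ℝ) : ℂ) -
        ((φ (e z) * (β (e z)).2 : ℝ) : ℂ) * I := by
      funext z
      apply Complex.ext <;> simp [hf2, hf1, he]
    have this := d3.congr_of_eventuallyEq (Eventually.of_forall fun z => congrFun hev z)
    have e1 : e 1 = (1, 0) := by simp [he]
    have e2 : e I = (0, 1) := by simp [he]
    simp [D, this.fderiv, e1, e2]
  obtain ⟨i2, E2⟩ := h.formula hf2c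
  obtain ⟨-, E1⟩ := h.formula hf1c
  have him : ∫ p, (m:ℝ) * (D f2 p * W γ v τ p).im = 0 := by
    rw [integral_const_mul]
    have : ∫ p, (D f2 p * W γ v τ p).im = (∫ p, D f2 p * W γ v τ p).im := 
      integral_im i2
    rw [this, E2]
    simp only [hf2v]
    rw [intervalIntegral.integral_ofReal, ← ofReal_ofNat, ← ofReal_mul, ← ofReal_mul, ofReal_im, mul_zero]
  have hval : ∀ p, W γ v τ p = m * (2 * Real.pi * I) →
      (m:ℝ) * (D f2 p * W γ v τ p).im = 2 * Real.pi * (m:ℝ)^2 * (D f2 p).re := by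
    intro p hp
    rw [hp]
    simp
    ring
  have hpi := Real.pi_pos
  have hnn : 0 ≤ᵐ[volume] fun p => (m:ℝ) * (D f2 p * W γ v τ p).im := by
    filter_upwards [hnull] with p hp
    rcases hm p hp with h0 | h0
    · simp [h0]
    · by_cases hpU : e p ∈ U
      · have := hdiv _ hpU
        rw [← hD] at this
        simp only [Pi.zero_apply]
        rw [hval p h0]
        positivity
      · simp [hout p hpU]
  have hz := (integral_eq_zero_iff_of_nonneg_ae hnn (i2.im.const_mul (m:ℝ))).1 him
  have hW0 : ∀ᵐ p : ℂ, W γ v τ p = 0 := by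
    filter_upwards [hnull, hz] with p hp hzp
    by_contra hW
    rcases hm p hp with h0 | h0
    · exact hW h0
    · have hpU : e p ∈ U := by
        by_contra hpU
        exact hW (hout p hpU)
      have hpos := hdiv _ hpU
      rw [← hD] at hpos
      simp only [Pi.zero_apply] at hzp
      rw [hval p h0] at hzp
      have hm0 : (m:ℝ) ≠ 0 := by
        intro hm0
        have : m = 0 := by exact_mod_cast hm0
        apply hW; rw [h0, this]; simp
      have : 0 < 2 * Real.pi * (m:ℝ)^2 * (D f2 p).re := by positivity
      linarith
  have hzero : ∫ p, D f1 p * W γ v τ p = 0 := by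
    rw [integral_eq_zero_of_ae]
    filter_upwards [hW0] with p hp
    simp [hp]
  rw [hzero] at E1
  simp only [hf1v] at E1
  rw [intervalIntegral.integral_ofReal, ← ofReal_ofNat, ← ofReal_mul, ← ofReal_mul] at E1
  have E1' : 0 = 2 * Real.pi * ∫ t in (0:ℝ)..τ, ‖v t‖ ^ 2 := by exact_mod_cast E1
  have hposint : 0 < ∫ t in (0:ℝ)..τ, ‖v t‖ ^ 2 := by
    refine intervalIntegral.intervalIntegral_pos_of_pos ?_ (fun t => ?_) h.pos
    · exact (h.cont.norm.pow 2).intervalIntegrable _ _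
    · have := norm_pos_iff.2 (h.ne t)
      positivity
  have : 0 < 2 * Real.pi * ∫ t in (0:ℝ)..τ, ‖v t‖ ^ 2 := by positivity
  linarith
end

section
/- Poincaré–Bendixson theorem: let f : ℝ² → ℝ² be continuously differentiable, let K ⊆ ℝ² be a compact set containing no zero of f, and let x : ℝ → ℝ² be a solution of x'(t) = f(x(t)) with x(t) ∈ K for all t ≥ 0. Then the ω-limit set ω(x) = ⋂_{s ≥ 0} closure{x(t) : t ≥ s} is the image of some nonconstant periodic solution p : ℝ → ℝ² of p'(t) = f(p(t)). -/
open Set Filter Topology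

/-- Cauchy-type integral along an arc. -/
noncomputable def pbA (u u' : ℝ → ℂ) (t1 t2 : ℝ) (z : ℂ) : ℂ :=
  ∫ t in t1..t2, u' t / (u t - z)

theorem pbA_local {u u' : ℝ → ℂ} (hu : ∀ t, HasDerivAt u (u' t) t) (hu' : Continuous u')
    {t1 t2 : ℝ} (h12 : t1 ≤ t2) {z0 : ℂ} (hz0 : z0 ∉ u '' Icc t1 t2) :
    ∀ᶠ z in 𝓝 z0, pbA u u' t1 t2 z = pbA u u' t1 t2 z0 +
      (Complex.log ((u t2 - z) / (u t2 - z0)) - Complex.log ((u t1 - z) / (u t1 - z0))) := by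
  have huc : Continuous u := continuous_iff_continuousAt.2 fun t => (hu t).continuousAt
  have hcl : IsClosed (u '' Icc t1 t2) := (isCompact_Icc.image huc).isClosed
  obtain ⟨r, hr, hball⟩ := Metric.isOpen_iff.1 hcl.isOpen_compl z0 hz0
  filter_upwards [Metric.ball_mem_nhds z0 hr] with z hz
  have hne : ∀ w ∈ Metric.ball z0 r, ∀ t ∈ Icc t1 t2, u t - w ≠ 0 := by
    intro w hw t ht h0
    exact hball hw ⟨t, ht, sub_eq_zero.1 h0⟩
  have hz0r : z0 ∈ Metric.ball z0 r := Metric.mem_ball_self hr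
  have hIntb : ∀ w ∈ Metric.ball z0 r,
      IntervalIntegrable (fun t => u' t / (u t - w)) MeasureTheory.volume t1 t2 := by
    intro w hw
    apply ContinuousOn.intervalIntegrable
    rw [uIcc_of_le h12]
    exact hu'.continuousOn.div (huc.continuousOn.sub continuousOn_const) (hne w hw)
  have key : ∫ t in t1..t2, (u' t / (u t - z) - u' t / (u t - z0)) =
      Complex.log ((u t2 - z) / (u t2 - z0)) - Complex.log ((u t1 - z) / (u t1 - z0)) := by
    apply intervalIntegral.integral_eq_sub_of_hasDerivAt
      (f := fun t => Complex.log ((u t - z) / (u t - z0)))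
    · intro t ht
      rw [uIcc_of_le h12] at ht
      have h1 := hne z hz t ht
      have h2 := hne z0 hz0r t ht
      have hslit : (u t - z) / (u t - z0) ∈ Complex.slitPlane := by
        have hlt : ‖(z - z0) / (u t - z0)‖ < 1 := by
          rw [norm_div, div_lt_one (norm_pos_iff.2 h2)]
          have h3 : ¬ (u t ∈ Metric.ball z0 r) := fun h => hball h ⟨t, ht, rfl⟩
          rw [Metric.mem_ball, dist_eq_norm] at h3 hz
          linarith
        have heq : (u t - z) / (u t - z0) = 1 - (z - z0) / (u t - z0) := by
          field_simp; ring
        left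
        rw [heq, Complex.sub_re, Complex.one_re]
        have := (Complex.abs_re_le_norm ((z - z0) / (u t - z0)))
        have := (abs_le.1 this).2
        linarith
      have hd := (((hu t).sub_const z).div ((hu t).sub_const z0) h2).clog_real hslit
      refine HasDerivAt.congr_deriv (f := fun t => Complex.log ((u t - z) / (u t - z0))) hd ?_
      simp only [Pi.div_apply]
      field_simp
    · exact (hIntb z hz).sub (hIntb z0 hz0r)
  rw [intervalIntegral.integral_sub (hIntb z hz) (hIntb z0 hz0r)] at key
  unfold pbA
  rw [← key]; ring

theorem pbA_deriv {u u' : ℝ → ℂ} (hu : ∀ t, HasDerivAt u (u' t) t) (hu' : Continuous u')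
    {t1 t2 : ℝ} (h12 : t1 ≤ t2) {z0 : ℂ} (hz0 : z0 ∉ u '' Icc t1 t2) :
    HasDerivAt (pbA u u' t1 t2) (1 / (z0 - u t2) - 1 / (z0 - u t1)) z0 := by
  have h1 : u t1 - z0 ≠ 0 := fun h => hz0 ⟨t1, ⟨le_rfl, h12⟩, sub_eq_zero.1 h⟩
  have h2 : u t2 - z0 ≠ 0 := fun h => hz0 ⟨t2, ⟨h12, le_rfl⟩, sub_eq_zero.1 h⟩
  have aux : ∀ p : ℂ, p - z0 ≠ 0 →
      HasDerivAt (fun z => Complex.log ((p - z) / (p - z0))) (1 / (z0 - p)) z0 := by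
    intro p hp
    have hp' : z0 - p ≠ 0 := by
      intro h; apply hp; rw [← neg_sub, h, neg_zero]
    have := (((hasDerivAt_id' z0).const_sub p).div_const (p - z0)).clog
      (by simp [div_self hp])
    convert this using 1
    rw [div_self hp, div_one, ← neg_sub z0 p, neg_div_neg_eq]
  have := ((aux _ h2).sub (aux _ h1)).const_add (pbA u u' t1 t2 z0)
  refine this.congr_of_eventuallyEq ?_
  filter_upwards [pbA_local hu hu' h12 hz0] with z hz
  rw [hz]; rfl

/-- branch of the winding function, slit to the left -/
noncomputable def pbP (u u' : ℝ → ℂ) (t1 t2 : ℝ) (z : ℂ) : ℂ :=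
  pbA u u' t1 t2 z + Complex.log (z - u t1) - Complex.log (z - u t2)

/-- branch of the winding function, slit to the right -/
noncomputable def pbM (u u' : ℝ → ℂ) (t1 t2 : ℝ) (z : ℂ) : ℂ :=
  pbA u u' t1 t2 z + Complex.log (u t1 - z) - Complex.log (u t2 - z)

theorem pb_evt_const {F : ℂ → ℂ} {O : Set ℂ} (hO : IsOpen O)
    (h : ∀ z ∈ O, HasDerivAt F 0 z) {z : ℂ} (hz : z ∈ O) : ∀ᶠ w in 𝓝 z, F w = F z := by
  obtain ⟨r, hr, hb⟩ := Metric.isOpen_iff.1 hO z hz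
  filter_upwards [Metric.ball_mem_nhds z hr] with w hw
  have hz' : z ∈ Metric.ball z r := Metric.mem_ball_self hr
  exact Metric.isOpen_ball.is_const_of_deriv_eq_zero (convex_ball z r).isPreconnected
    (fun y hy => (h y (hb hy)).differentiableAt.differentiableWithinAt)
    (fun y hy => (h y (hb hy)).deriv) hw hz'

theorem pbP_const {u u' : ℝ → ℂ} (hu : ∀ t, HasDerivAt u (u' t) t) (hu' : Continuous u')
    {t1 t2 : ℝ} (h12 : t1 ≤ t2) {z : ℂ} (hz : z ∉ u '' Icc t1 t2)
    (h1 : z - u t1 ∈ Complex.slitPlane) (h2 : z - u t2 ∈ Complex.slitPlane) :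
    ∀ᶠ w in 𝓝 z, pbP u u' t1 t2 w = pbP u u' t1 t2 z := by
  have huc : Continuous u := continuous_iff_continuousAt.2 fun t => (hu t).continuousAt
  have hcl : IsClosed (u '' Icc t1 t2) := (isCompact_Icc.image huc).isClosed
  apply pb_evt_const (O := (u '' Icc t1 t2)ᶜ ∩ ((fun z => z - u t1) ⁻¹' Complex.slitPlane ∩
    (fun z => z - u t2) ⁻¹' Complex.slitPlane)) _ _ ⟨hz, h1, h2⟩
  · exact hcl.isOpen_compl.inter ((Complex.isOpen_slitPlane.preimage (by fun_prop)).inter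
      (Complex.isOpen_slitPlane.preimage (by fun_prop)))
  · rintro y ⟨hy, hy1, hy2⟩
    have := ((pbA_deriv hu hu' h12 hy).add (((hasDerivAt_id' y).sub_const (u t1)).clog hy1)).sub
      (((hasDerivAt_id' y).sub_const (u t2)).clog hy2)
    refine HasDerivAt.congr_deriv (f := pbP u u' t1 t2) this ?_
    ring

theorem pbM_const {u u' : ℝ → ℂ} (hu : ∀ t, HasDerivAt u (u' t) t) (hu' : Continuous u')
    {t1 t2 : ℝ} (h12 : t1 ≤ t2) {z : ℂ} (hz : z ∉ u '' Icc t1 t2)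
    (h1 : u t1 - z ∈ Complex.slitPlane) (h2 : u t2 - z ∈ Complex.slitPlane) :
    ∀ᶠ w in 𝓝 z, pbM u u' t1 t2 w = pbM u u' t1 t2 z := by
  have huc : Continuous u := continuous_iff_continuousAt.2 fun t => (hu t).continuousAt
  have hcl : IsClosed (u '' Icc t1 t2) := (isCompact_Icc.image huc).isClosed
  apply pb_evt_const (O := (u '' Icc t1 t2)ᶜ ∩ ((fun z => u t1 - z) ⁻¹' Complex.slitPlane ∩
    (fun z => u t2 - z) ⁻¹' Complex.slitPlane)) _ _ ⟨hz, h1, h2⟩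
  · exact hcl.isOpen_compl.inter ((Complex.isOpen_slitPlane.preimage (by fun_prop)).inter
      (Complex.isOpen_slitPlane.preimage (by fun_prop)))
  · rintro y ⟨hy, hy1, hy2⟩
    have := ((pbA_deriv hu hu' h12 hy).add (((hasDerivAt_id' y).const_sub (u t1)).clog hy1)).sub
      (((hasDerivAt_id' y).const_sub (u t2)).clog hy2)
    refine HasDerivAt.congr_deriv (f := pbM u u' t1 t2) this ?_
    rw [← neg_sub y (u t1), ← neg_sub y (u t2), neg_div_neg_eq, neg_div_neg_eq]
    ring

theorem pb_log_neg_pos {w : ℂ} (h : 0 < w.im) :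
    Complex.log (-w) = Complex.log w - Real.pi * Complex.I := by
  unfold Complex.log
  rw [norm_neg, Complex.arg_neg_eq_arg_sub_pi_of_im_pos h]; push_cast; ring

theorem pb_log_neg_neg {w : ℂ} (h : w.im < 0) :
    Complex.log (-w) = Complex.log w + Real.pi * Complex.I := by
  unfold Complex.log
  rw [norm_neg, Complex.arg_neg_eq_arg_add_pi_of_im_neg h]; push_cast; ring

theorem pb_eq_above {u u' : ℝ → ℂ} {t1 t2 : ℝ} {z : ℂ} (h1 : (u t1).im < z.im)
    (h2 : (u t2).im < z.im) : pbM u u' t1 t2 z = pbP u u' t1 t2 z := by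
  unfold pbM pbP
  rw [← neg_sub z (u t1), ← neg_sub z (u t2), pb_log_neg_pos (by simpa using h1),
    pb_log_neg_pos (by simpa using h2)]
  ring

theorem pb_eq_below {u u' : ℝ → ℂ} {t1 t2 : ℝ} {z : ℂ} (h1 : z.im < (u t1).im)
    (h2 : z.im < (u t2).im) : pbM u u' t1 t2 z = pbP u u' t1 t2 z := by
  unfold pbM pbP
  rw [← neg_sub z (u t1), ← neg_sub z (u t2), pb_log_neg_neg (by simpa using h1),
    pb_log_neg_neg (by simpa using h2)]
  ring

theorem pb_jump {u u' : ℝ → ℂ} {t1 t2 : ℝ} {z : ℂ} (h1 : (u t1).im < z.im)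
    (h2 : z.im < (u t2).im) :
    pbM u u' t1 t2 z = pbP u u' t1 t2 z - 2 * (Real.pi * Complex.I) := by
  unfold pbM pbP
  rw [← neg_sub z (u t1), ← neg_sub z (u t2), pb_log_neg_pos (by simpa using h1),
    pb_log_neg_neg (by simpa using h2)]
  ring

theorem pb_preconn_const {F : ℂ → ℂ} {S : Set ℂ} (hS : IsPreconnected S)
    (h : ∀ z ∈ S, ∀ᶠ w in 𝓝 z, F w = F z) {z w : ℂ} (hz : z ∈ S) (hw : w ∈ S) : F z = F w :=
  hS.induction₂ (fun z w => F z = F w)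
    (fun z hz => mem_nhdsWithin_of_mem_nhds ((h z hz).mono fun _ e => e.symm))
    (fun _ _ _ _ _ _ h1 h2 => h1.trans h2) (fun _ _ _ _ h1 => h1.symm) hz hw

theorem pb_hasDerivAt_re {u : ℝ → ℂ} {v : ℂ} {t : ℝ} (h : HasDerivAt u v t) :
    HasDerivAt (fun s => (u s).re) v.re t :=
  Complex.reCLM.hasFDerivAt.comp_hasDerivAt t h

theorem pb_sign {g : ℝ → ℝ} {d t : ℝ} (h : HasDerivAt g d t) (hd : 0 < d) (h0 : g t = 0) :
    ∀ᶠ s in 𝓝 t, (s < t → g s < 0) ∧ (t < s → 0 < g s) := by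
  have h1 := (hasDerivAt_iff_tendsto_slope.1 h).eventually (lt_mem_nhds hd)
  rw [eventually_nhdsWithin_iff] at h1
  filter_upwards [h1] with s hs
  constructor
  · intro hlt
    have := hs (ne_of_lt hlt)
    rw [slope_def_field, h0, sub_zero] at this
    rcases div_pos_iff.1 this with h | h
    · linarith [h.2]
    · exact h.1
  · intro hlt
    have := hs (ne_of_gt hlt)
    rw [slope_def_field, h0, sub_zero] at this
    rcases div_pos_iff.1 this with h | h
    · exact h.1
    · linarith [h.2]

theorem pb_half_right {q : ℂ} {η : ℝ} (hq : q.re = 0) :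
    IsPreconnected (Metric.ball q η ∩ {z | 0 ≤ z.re ∧ z ≠ q}) := by
  have hT : IsPreconnected (Metric.ball q η ∩ {z | 0 < z.re}) :=
    ((convex_ball q η).inter (convex_halfSpace_re_gt 0)).isPreconnected
  refine hT.subset_closure ?_ ?_
  · rintro z ⟨hz, hz'⟩
    refine ⟨hz, le_of_lt hz', ?_⟩
    rintro rfl
    exact (lt_irrefl _ (hq ▸ hz' : (0 : ℝ) < 0))
  · rintro z ⟨hz, hz', -⟩
    have ht : Tendsto (fun ε : ℝ => z + (ε : ℂ)) (𝓝[>] 0) (𝓝 z) := by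
      have : Tendsto (fun ε : ℝ => z + (ε : ℂ)) (𝓝 0) (𝓝 (z + ((0 : ℝ) : ℂ))) :=
        Continuous.tendsto (by fun_prop) 0
      simpa using this.mono_left nhdsWithin_le_nhds
    refine mem_closure_of_tendsto ht ?_
    filter_upwards [ht.eventually (Metric.isOpen_ball.mem_nhds hz), self_mem_nhdsWithin]
      with ε h1 h2
    refine ⟨h1, ?_⟩
    have : (0 : ℝ) < ε := h2
    simp only [mem_ofPred_eq, Complex.add_re, Complex.ofReal_re]
    linarith

theorem pb_half_left {q : ℂ} {η : ℝ} (hq : q.re = 0) :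
    IsPreconnected (Metric.ball q η ∩ {z | z.re ≤ 0 ∧ z ≠ q}) := by
  have hT : IsPreconnected (Metric.ball q η ∩ {z | z.re < 0}) :=
    ((convex_ball q η).inter (convex_halfSpace_re_lt 0)).isPreconnected
  refine hT.subset_closure ?_ ?_
  · rintro z ⟨hz, hz'⟩
    refine ⟨hz, le_of_lt hz', ?_⟩
    rintro rfl
    exact (lt_irrefl _ (hq ▸ hz' : (0 : ℝ) < 0))
  · rintro z ⟨hz, hz', -⟩
    have ht : Tendsto (fun ε : ℝ => z - (ε : ℂ)) (𝓝[>] 0) (𝓝 z) := by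
      have : Tendsto (fun ε : ℝ => z - (ε : ℂ)) (𝓝 0) (𝓝 (z - ((0 : ℝ) : ℂ))) :=
        Continuous.tendsto (by fun_prop) 0
      simpa using this.mono_left nhdsWithin_le_nhds
    refine mem_closure_of_tendsto ht ?_
    filter_upwards [ht.eventually (Metric.isOpen_ball.mem_nhds hz), self_mem_nhdsWithin]
      with ε h1 h2
    refine ⟨h1, ?_⟩
    have : (0 : ℝ) < ε := h2
    simp only [mem_ofPred_eq, Complex.sub_re, Complex.ofReal_re]
    linarith

theorem pb_core {u u' : ℝ → ℂ} (hu : ∀ t, HasDerivAt u (u' t) t) (hu' : Continuous u')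
    (hinj : Function.Injective u) {t1 t2 t3 α β : ℝ} (h12 : t1 < t2) (h23 : t2 < t3)
    (hhit : ∀ t, (u t).re = 0 → (u t).im ∈ Icc α β → 0 < (u' t).re)
    (r1 : (u t1).re = 0) (r2 : (u t2).re = 0) (r3 : (u t3).re = 0)
    (i1 : (u t1).im ∈ Icc α β) (i2 : (u t2).im ∈ Icc α β) (i3 : (u t3).im ∈ Icc α β)
    (no12 : ∀ t ∈ Ioo t1 t2, (u t).re = 0 → (u t).im ∉ Icc α β)
    (no23 : ∀ t ∈ Ioo t2 t3, (u t).re = 0 → (u t).im ∉ Icc α β)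
    (lt12 : (u t1).im < (u t2).im) (lt32 : (u t3).im < (u t2).im) : False := by
  have huc : Continuous u := continuous_iff_continuousAt.2 fun t => (hu t).continuousAt
  set Γ := u '' Icc t1 t2 with hΓ
  have hp : u t1 ∈ Γ := ⟨t1, ⟨le_rfl, h12.le⟩, rfl⟩
  have hq : u t2 ∈ Γ := ⟨t2, ⟨h12.le, le_rfl⟩, rfl⟩
  have arc_hit : ∀ z ∈ Γ, z.re = 0 → z.im ∈ Icc α β → z = u t1 ∨ z = u t2 := by
    rintro z ⟨t, ⟨ha, hb⟩, rfl⟩ h0 h1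
    rcases eq_or_lt_of_le ha with rfl | ha
    · exact Or.inl rfl
    rcases eq_or_lt_of_le hb with rfl | hb
    · exact Or.inr rfl
    exact absurd h1 (no12 t ⟨ha, hb⟩ h0)
  set P := pbP u u' t1 t2 with hP
  set M := pbM u u' t1 t2 with hM
  have Pc : ∀ z, z ∉ Γ → 0 ≤ z.re → ∀ᶠ w in 𝓝 z, P w = P z := by
    intro z hz hre
    have aux : ∀ p ∈ Γ, p.re = 0 → z - p ∈ Complex.slitPlane := by
      intro p hpΓ hp0
      rw [Complex.mem_slitPlane_iff, Complex.sub_re, Complex.sub_im, hp0, sub_zero]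
      rcases eq_or_lt_of_le hre with h | h
      · right
        intro h'
        apply hz
        have : z = p := Complex.ext (by rw [hp0, ← h]) (sub_eq_zero.1 h')
        rwa [this]
      · exact Or.inl h
    exact pbP_const hu hu' h12.le hz (aux _ hp r1) (aux _ hq r2)
  have Mc : ∀ z, z ∉ Γ → z.re ≤ 0 → ∀ᶠ w in 𝓝 z, M w = M z := by
    intro z hz hre
    have aux : ∀ p ∈ Γ, p.re = 0 → p - z ∈ Complex.slitPlane := by
      intro p hpΓ hp0
      rw [Complex.mem_slitPlane_iff, Complex.sub_re, Complex.sub_im, hp0, zero_sub]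
      rcases eq_or_lt_of_le hre with h | h
      · right
        intro h'
        apply hz
        have : z = p := Complex.ext (by rw [hp0, ← h]) (sub_eq_zero.1 h').symm
        rwa [this]
      · left; linarith
    exact pbM_const hu hu' h12.le hz (aux _ hp r1) (aux _ hq r2)
  set G : ℂ → ℂ := fun z => if 0 ≤ z.re then P z else M z with hG
  have Gc : ∀ z, z ∉ Γ → (z.re = 0 → z.im < (u t1).im ∨ (u t2).im < z.im) →
      ∀ᶠ w in 𝓝 z, G w = G z := by
    intro z hz himp
    rcases lt_trichotomy z.re 0 with h | h | h
    · filter_upwards [Mc z hz h.le, Complex.continuous_re.continuousAt.eventually (gt_mem_nhds h)]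
        with w h1 h2
      simp only [hG, if_neg (not_le.2 h2), if_neg (not_le.2 h), h1]
    · have hPM : M z = P z := by
        rcases himp h with h' | h'
        · exact pb_eq_below h' (h'.trans lt12)
        · exact pb_eq_above (lt12.trans h') h'
      filter_upwards [Mc z hz h.le, Pc z hz h.ge] with w h1 h2
      simp only [hG, h.ge, if_true]
      split_ifs
      · exact h2
      · rw [h1, hPM]
    · filter_upwards [Pc z hz h.le, Complex.continuous_re.continuousAt.eventually (lt_mem_nhds h)]
        with w h1 h2
      simp only [hG, if_pos (le_of_lt h2), if_pos h.le, h1]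
  have notΓ : ∀ t, t2 < t → u t ∉ Γ := by
    rintro t ht ⟨s, hs, hst⟩
    have := hinj hst
    subst this
    exact absurd hs.2 (not_le.2 ht)
  have Gw : ∀ s ∈ Ioo t2 t3, ∀ t ∈ Ioo t2 t3, G (u s) = G (u t) := by
    intro s hs t ht
    refine pb_preconn_const (S := u '' Ioo t2 t3)
      (isPreconnected_Ioo.image u huc.continuousOn) ?_ ⟨s, hs, rfl⟩ ⟨t, ht, rfl⟩
    rintro z ⟨τ, hτ, rfl⟩
    refine Gc _ (notΓ τ hτ.1) fun h0 => ?_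
    have := no23 τ hτ h0
    by_contra hcon
    push Not at hcon
    exact this ⟨i1.1.trans hcon.1, hcon.2.trans i2.2⟩
  -- half discs
  have half2 : ∀ᶠ z in 𝓝 (u t2), 0 ≤ z.re → z ≠ u t2 → z ∉ Γ := by
    obtain ⟨δ, hδ, hδ'⟩ := Metric.eventually_nhds_iff.1
      (pb_sign (pb_hasDerivAt_re (hu t2)) (hhit t2 r2 i2) r2)
    have hcl : IsClosed (u '' Icc t1 (t2 - δ)) := (isCompact_Icc.image huc).isClosed
    have hn : u t2 ∈ (u '' Icc t1 (t2 - δ))ᶜ := by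
      rintro ⟨s, hs, hst⟩
      have := hinj hst
      have := hs.2
      linarith
    filter_upwards [hcl.isOpen_compl.mem_nhds hn] with z hz hre hne
    rintro ⟨s, hs, rfl⟩
    have h1 : s ≠ t2 := fun h => hne (by rw [h])
    have h2 : s < t2 := lt_of_le_of_ne hs.2 h1
    have h3 : t2 - δ < s := by
      by_contra hcon
      exact hz ⟨s, ⟨hs.1, not_lt.1 hcon⟩, rfl⟩
    have := (hδ' (y := s) (by rw [Real.dist_eq, abs_lt]; constructor <;> linarith)).1 h2
    linarith
  have half1 : ∀ᶠ z in 𝓝 (u t1), z.re ≤ 0 → z ≠ u t1 → z ∉ Γ := by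
    obtain ⟨δ, hδ, hδ'⟩ := Metric.eventually_nhds_iff.1
      (pb_sign (pb_hasDerivAt_re (hu t1)) (hhit t1 r1 i1) r1)
    have hcl : IsClosed (u '' Icc (t1 + δ) t2) := (isCompact_Icc.image huc).isClosed
    have hn : u t1 ∈ (u '' Icc (t1 + δ) t2)ᶜ := by
      rintro ⟨s, hs, hst⟩
      have := hinj hst
      have := hs.1
      linarith
    filter_upwards [hcl.isOpen_compl.mem_nhds hn] with z hz hre hne
    rintro ⟨s, hs, rfl⟩
    have h1 : s ≠ t1 := fun h => hne (by rw [h])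
    have h2 : t1 < s := lt_of_le_of_ne hs.1 h1.symm
    have h3 : s < t1 + δ := by
      by_contra hcon
      exact hz ⟨s, ⟨not_lt.1 hcon, hs.2⟩, rfl⟩
    have := (hδ' (y := s) (by rw [Real.dist_eq, abs_lt]; constructor <;> linarith)).2 h2
    linarith
  obtain ⟨η2, hη2, hb2⟩ := Metric.eventually_nhds_iff_ball.1 half2
  obtain ⟨η1, hη1, hb1⟩ := Metric.eventually_nhds_iff_ball.1 half1
  -- the section
  let σ : ℝ → ℂ := fun c => ⟨0, c⟩
  have hσ : Continuous σ := by
    have : σ = fun c : ℝ => (c : ℂ) * Complex.I := by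
      funext c; apply Complex.ext <;> simp [σ]
    rw [this]; fun_prop
  have σ1 : σ (u t1).im = u t1 := Complex.ext r1.symm rfl
  have σ2 : σ (u t2).im = u t2 := Complex.ext r2.symm rfl
  have σ3 : σ (u t3).im = u t3 := Complex.ext r3.symm rfl
  have σne : ∀ c t, c ≠ (u t).im → σ c ≠ u t := by
    intro c t h h'
    apply h; rw [← h']
  have σΓ : ∀ c ∈ Icc α β, c ≠ (u t1).im → c ≠ (u t2).im → σ c ∉ Γ := by
    intro c hc h1 h2 hmem
    rcases arc_hit _ hmem rfl hc with h | h
    · exact σne c t1 h1 h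
    · exact σne c t2 h2 h
  have Pseg : ∀ c ∈ Ioo (u t1).im (u t2).im, ∀ d ∈ Ioo (u t1).im (u t2).im,
      P (σ c) = P (σ d) := by
    intro c hc d hd
    refine pb_preconn_const (S := σ '' Ioo (u t1).im (u t2).im)
      (isPreconnected_Ioo.image σ hσ.continuousOn) ?_ ⟨c, hc, rfl⟩ ⟨d, hd, rfl⟩
    rintro z ⟨τ, hτ, rfl⟩
    exact Pc _ (σΓ τ ⟨i1.1.trans hτ.1.le, hτ.2.le.trans i2.2⟩ hτ.1.ne' hτ.2.ne) le_rfl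
  have Mseg : ∀ c ∈ Ico α (u t1).im, ∀ d ∈ Ico α (u t1).im, M (σ c) = M (σ d) := by
    intro c hc d hd
    refine pb_preconn_const (S := σ '' Ico α (u t1).im)
      (isPreconnected_Ico.image σ hσ.continuousOn) ?_ ⟨c, hc, rfl⟩ ⟨d, hd, rfl⟩
    rintro z ⟨τ, hτ, rfl⟩
    exact Mc _ (σΓ τ ⟨hτ.1, hτ.2.le.trans i1.2⟩ hτ.2.ne (hτ.2.trans lt12).ne) le_rfl
  -- right half disc at u t2
  obtain ⟨τ, hτ, c, hc, hPτ⟩ : ∃ τ ∈ Ioo t2 t3, ∃ c ∈ Ioo (u t1).im (u t2).im,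
      G (u τ) = P (σ c) := by
    have e1 : ∀ᶠ t in 𝓝[>] t2, t ∈ Ioo t2 t3 ∧ u t ∈ Metric.ball (u t2) η2 ∧ 0 < (u t).re := by
      have s1 := nhdsWithin_le_nhds (s := Ioi t2)
        (pb_sign (pb_hasDerivAt_re (hu t2)) (hhit t2 r2 i2) r2)
      have s2 := nhdsWithin_le_nhds (s := Ioi t2)
        (huc.continuousAt.eventually (Metric.ball_mem_nhds (u t2) hη2))
      filter_upwards [s1, s2, Ioo_mem_nhdsGT h23] with t h1 h2 h3
      exact ⟨h3, h2, h1.2 h3.1⟩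
    obtain ⟨τ, hτ, hτ2, hτ3⟩ := e1.exists
    have e2 : ∀ᶠ c in 𝓝[<] (u t2).im, c ∈ Ioo (u t1).im (u t2).im ∧
        σ c ∈ Metric.ball (u t2) η2 := by
      have s2 := nhdsWithin_le_nhds (s := Iio (u t2).im)
        (hσ.continuousAt.eventually (Metric.ball_mem_nhds (σ (u t2).im) hη2))
      rw [σ2] at s2
      filter_upwards [s2, Ioo_mem_nhdsLT lt12] with t h2 h3
      exact ⟨h3, h2⟩
    obtain ⟨c, hc, hc2⟩ := e2.exists
    refine ⟨τ, hτ, c, hc, ?_⟩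
    simp only [hG, if_pos hτ3.le]
    refine pb_preconn_const (pb_half_right r2) ?_
      ⟨hτ2, hτ3.le, fun h => hτ.1.ne' (hinj h)⟩ ⟨hc2, le_rfl, σne c t2 hc.2.ne⟩
    rintro z ⟨hz, hz1, hz2⟩
    exact Pc z (hb2 z hz hz1 hz2) hz1
  -- left half disc at u t1
  have Mleft : ∀ d ∈ Ico α (u t1).im, ∃ c ∈ Ioo (u t1).im (u t2).im, M (σ d) = M (σ c) := by
    intro d hd
    have s2 := hσ.continuousAt.eventually (Metric.ball_mem_nhds (σ (u t1).im) hη1)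
    rw [σ1] at s2
    obtain ⟨c, hc, hc2⟩ : ∃ c, σ c ∈ Metric.ball (u t1) η1 ∧ c ∈ Ioo (u t1).im (u t2).im :=
      ((s2.filter_mono (nhdsWithin_le_nhds (s := Ioi (u t1).im))).and (Ioo_mem_nhdsGT lt12)).exists
    obtain ⟨e, he, he2⟩ : ∃ e, σ e ∈ Metric.ball (u t1) η1 ∧ e ∈ Ioo d (u t1).im :=
      ((s2.filter_mono (nhdsWithin_le_nhds (s := Iio (u t1).im))).and (Ioo_mem_nhdsLT hd.2)).exists
    refine ⟨c, hc2, ?_⟩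
    rw [Mseg d hd e ⟨hd.1.trans he2.1.le, he2.2⟩]
    refine pb_preconn_const (pb_half_left r1) ?_
      ⟨he, le_rfl, σne e t1 he2.2.ne⟩ ⟨hc, le_rfl, σne c t1 hc2.1.ne'⟩
    rintro z ⟨hz, hz1, hz2⟩
    exact Mc z (hb1 z hz hz1 hz2) hz1
  -- at t3
  obtain ⟨τ3, hτ3, hM3⟩ : ∃ τ3 ∈ Ioo t2 t3, G (u τ3) = M (u t3) := by
    have s1 := (pb_sign (pb_hasDerivAt_re (hu t3)) (hhit t3 r3 i3) r3).filter_mono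
      (nhdsWithin_le_nhds (s := Iio t3))
    have s2 := (huc.continuousAt.eventually (Mc (u t3) (notΓ t3 h23) r3.le)).filter_mono
      (nhdsWithin_le_nhds (s := Iio t3))
    obtain ⟨t, h1, h2, h3⟩ := (s1.and (s2.and (Ioo_mem_nhdsLT h23))).exists
    refine ⟨t, h3, ?_⟩
    simp only [hG, if_neg (not_le.2 (h1.1 h3.2)), h2]
  have hfin : ∃ d ∈ Ioo (u t1).im (u t2).im, M (u t3) = M (σ d) := by
    rcases lt_trichotomy (u t3).im (u t1).im with h | h | h
    · have := Mleft (u t3).im ⟨i3.1, h⟩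
      rwa [σ3] at this
    · exact absurd (hinj (Complex.ext (r3.trans r1.symm) h)) (h12.trans h23).ne'
    · exact ⟨(u t3).im, ⟨h, lt32⟩, by rw [σ3]⟩
  obtain ⟨d, hd, hMd⟩ := hfin
  have hj : M (σ d) = P (σ d) - 2 * (Real.pi * Complex.I) := pb_jump hd.1 hd.2
  have : P (σ d) = P (σ d) - 2 * (Real.pi * Complex.I) := by
    rw [← hj, ← hMd, ← hM3, Gw τ3 hτ3 τ hτ, hPτ, Pseg d hd c hc]
  have h0 : (2 * (Real.pi * Complex.I) : ℂ) = 0 := by linear_combination this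
  simp [Real.pi_ne_zero] at h0

theorem pb_mono {u u' : ℝ → ℂ} (hu : ∀ t, HasDerivAt u (u' t) t) (hu' : Continuous u')
    (hinj : Function.Injective u) {t1 t2 t3 α β : ℝ} (h12 : t1 < t2) (h23 : t2 < t3)
    (hhit : ∀ t, (u t).re = 0 → (u t).im ∈ Icc α β → 0 < (u' t).re)
    (r1 : (u t1).re = 0) (r2 : (u t2).re = 0) (r3 : (u t3).re = 0)
    (i1 : (u t1).im ∈ Icc α β) (i2 : (u t2).im ∈ Icc α β) (i3 : (u t3).im ∈ Icc α β)
    (lt12 : (u t1).im < (u t2).im) (lt32 : (u t3).im < (u t2).im) : False := by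
  have huc : Continuous u := continuous_iff_continuousAt.2 fun t => (hu t).continuousAt
  set H : Set ℝ := {t | (u t).re = 0 ∧ (u t).im ∈ Icc α β} with hH
  have hHc : IsClosed H :=
    (isClosed_eq (Complex.continuous_re.comp huc) continuous_const).inter
      (isClosed_Icc.preimage (Complex.continuous_im.comp huc))
  obtain ⟨s2, ⟨hs2, hs2H⟩, hmax⟩ := (isCompact_Icc.inter_right hHc : IsCompact (Icc t1 t3 ∩ H)).exists_isMaxOn
    ⟨t2, ⟨h12.le, h23.le⟩, r2, i2⟩ (Complex.continuous_im.comp huc).continuousOn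
  have hmax' : ∀ t ∈ Icc t1 t3 ∩ H, (u t).im ≤ (u s2).im := fun t ht => hmax ht
  have hm2 := hmax' t2 ⟨⟨h12.le, h23.le⟩, r2, i2⟩
  have hs21 : t1 < s2 := by
    refine lt_of_le_of_ne hs2.1 ?_
    rintro rfl; linarith
  have hs23 : s2 < t3 := by
    refine lt_of_le_of_ne hs2.2 ?_
    rintro rfl; linarith
  obtain ⟨δ, hδ, hδ'⟩ := Metric.eventually_nhds_iff.1
    (pb_sign (pb_hasDerivAt_re (hu s2)) (hhit s2 hs2H.1 hs2H.2) hs2H.1)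
  have iso : ∀ t ∈ H, t < s2 → t ≤ s2 - δ := by
    intro t ht hlt
    by_contra hcon
    have := (hδ' (y := t) (by rw [Real.dist_eq, abs_lt]; constructor <;> linarith)).1 hlt
    exact this.ne ht.1
  have iso' : ∀ t ∈ H, s2 < t → s2 + δ ≤ t := by
    intro t ht hlt
    by_contra hcon
    have := (hδ' (y := t) (by rw [Real.dist_eq, abs_lt]; constructor <;> linarith)).2 hlt
    exact this.ne' ht.1
  have hH1 : t1 ∈ H := ⟨r1, i1⟩
  have hH3 : t3 ∈ H := ⟨r3, i3⟩
  obtain ⟨s1, ⟨hs1, hs1H⟩, hg⟩ :=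
    (isCompact_Icc.inter_right hHc : IsCompact (Icc t1 (s2 - δ) ∩ H)).exists_isGreatest
      ⟨t1, ⟨le_rfl, iso t1 hH1 hs21⟩, hH1⟩
  obtain ⟨s3, ⟨hs3, hs3H⟩, hl⟩ :=
    (isCompact_Icc.inter_right hHc : IsCompact (Icc (s2 + δ) t3 ∩ H)).exists_isLeast
      ⟨t3, ⟨iso' t3 hH3 hs23, le_rfl⟩, hH3⟩
  have l12 : s1 < s2 := by linarith [hs1.2]
  have l23 : s2 < s3 := by linarith [hs3.1]
  refine pb_core hu hu' hinj l12 l23 hhit hs1H.1 hs2H.1 hs3H.1 hs1H.2 hs2H.2 hs3H.2 ?_ ?_ ?_ ?_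
  · intro t ht h0 h1
    have := hg ⟨⟨hs1.1.trans ht.1.le, iso t ⟨h0, h1⟩ ht.2⟩, h0, h1⟩
    exact absurd this (not_le.2 ht.1)
  · intro t ht h0 h1
    have := hl ⟨⟨iso' t ⟨h0, h1⟩ ht.1, ht.2.le.trans hs3.2⟩, h0, h1⟩
    exact absurd this (not_le.2 ht.2)
  · refine lt_of_le_of_ne (hmax' s1 ⟨⟨hs1.1, by linarith⟩, hs1H⟩) fun h => ?_
    exact l12.ne (hinj (Complex.ext (hs1H.1.trans hs2H.1.symm) h))
  · refine lt_of_le_of_ne (hmax' s3 ⟨⟨by linarith, hs3.2⟩, hs3H⟩) fun h => ?_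
    exact l23.ne' (hinj (Complex.ext (hs3H.1.trans hs2H.1.symm) h))

/-- the omega limit set -/
def pbOm (x : ℝ → ℂ) : Set ℂ := ⋂ s ∈ Set.Ici (0 : ℝ), closure (x '' Set.Ici s)

theorem pbOm_iff {x : ℝ → ℂ} {q : ℂ} :
    q ∈ pbOm x ↔ ∀ T : ℝ, ∀ ε > 0, ∃ t, T ≤ t ∧ dist (x t) q < ε := by
  simp only [pbOm, mem_iInter, Metric.mem_closure_iff]
  constructor
  · intro h T ε hε
    obtain ⟨_, ⟨t, ht, rfl⟩, hd⟩ := h (max T 0) (mem_Ici.2 (le_max_right _ _)) ε hε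
    exact ⟨t, (le_max_left _ _).trans ht, by rwa [dist_comm]⟩
  · intro h s _ ε hε
    obtain ⟨t, ht, hd⟩ := h s ε hε
    exact ⟨_, ⟨t, ht, rfl⟩, by rwa [dist_comm]⟩

theorem pbOm_closed (x : ℝ → ℂ) : IsClosed (pbOm x) :=
  isClosed_biInter fun _ _ => isClosed_closure

theorem pbOm_sub {x : ℝ → ℂ} {K : Set ℂ} (hK : IsCompact K) (hxK : ∀ t : ℝ, 0 ≤ t → x t ∈ K) :
    pbOm x ⊆ K := by
  intro q hq
  have h := mem_iInter₂.1 hq 0 (mem_Ici.2 le_rfl)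
  refine closure_minimal ?_ hK.isClosed h
  rintro _ ⟨t, ht, rfl⟩
  exact hxK t ht

theorem pb_lip {f : ℂ → ℂ} (hf : ContDiff ℝ 1 f) (K : Set ℂ) (hK : IsCompact K) :
    ∃ L, LipschitzOnWith L f K :=
  LocallyLipschitzOn.exists_lipschitzOnWith_of_compact hK
    (hf.locallyLipschitz.locallyLipschitzOn)

theorem pb_gron {f : ℂ → ℂ} {K : Set ℂ} {L : NNReal} (hL : LipschitzOnWith L f K)
    {y z : ℝ → ℂ} (hy : ∀ t, HasDerivAt y (f (y t)) t) (hz : ∀ t, HasDerivAt z (f (z t)) t)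
    (s : ℝ) (hyK : ∀ t ∈ uIcc 0 s, y t ∈ K) (hzK : ∀ t ∈ uIcc 0 s, z t ∈ K) :
    dist (y s) (z s) ≤ dist (y 0) (z 0) * Real.exp (L * |s|) := by
  have hyc : Continuous y := continuous_iff_continuousAt.2 fun t => (hy t).continuousAt
  have hzc : Continuous z := continuous_iff_continuousAt.2 fun t => (hz t).continuousAt
  rcases le_total 0 s with h | h
  · rw [uIcc_of_le h] at hyK hzK
    have := dist_le_of_trajectories_ODE_of_mem (v := fun _ => f) (s := fun _ => K) (a := 0) (b := s)
      (fun _ _ => hL) hyc.continuousOn (fun t _ => (hy t).hasDerivWithinAt)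
      (fun t ht => hyK t (Ico_subset_Icc_self ht)) hzc.continuousOn
      (fun t _ => (hz t).hasDerivWithinAt) (fun t ht => hzK t (Ico_subset_Icc_self ht))
      le_rfl s ⟨h, le_rfl⟩
    rw [sub_zero] at this
    rwa [abs_of_nonneg h]
  · rw [uIcc_of_ge h] at hyK hzK
    have hrev : ∀ w : ℝ → ℂ, (∀ t, HasDerivAt w (f (w t)) t) →
        ∀ t, HasDerivAt (fun t => w (-t)) (-f (w (-t))) t := by
      intro w hw t
      have := (hw (-t)).scomp t (hasDerivAt_neg t)
      simpa [Function.comp_def] using this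
    have := dist_le_of_trajectories_ODE_of_mem (v := fun _ z => - f z) (s := fun _ => K)
      (a := 0) (b := -s) (f := fun t => y (-t)) (g := fun t => z (-t))
      (fun _ _ => hL.neg) (hyc.comp continuous_neg).continuousOn
      (fun t _ => (hrev y hy t).hasDerivWithinAt)
      (fun t ht => hyK (-t) ⟨by linarith [ht.2], by linarith [ht.1]⟩)
      (hzc.comp continuous_neg).continuousOn
      (fun t _ => (hrev z hz t).hasDerivWithinAt)
      (fun t ht => hzK (-t) ⟨by linarith [ht.2], by linarith [ht.1]⟩)
      le_rfl (-s) ⟨by linarith, le_rfl⟩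
    simpa [abs_of_nonpos h] using this

theorem pb_shift {f : ℂ → ℂ} {y : ℝ → ℂ} (hy : ∀ t, HasDerivAt y (f (y t)) t) (c : ℝ) :
    ∀ t, HasDerivAt (fun t => y (t + c)) (f (y (t + c))) t :=
  fun t => (hy (t + c)).comp_add_const t c

theorem pb_uniq {f : ℂ → ℂ} (hf : ContDiff ℝ 1 f) {y z : ℝ → ℂ}
    (hy : ∀ t, HasDerivAt y (f (y t)) t) (hz : ∀ t, HasDerivAt z (f (z t)) t)
    {a b : ℝ} (hab : y a = z b) (s : ℝ) : y (s + a) = z (s + b) := by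
  have hyc : Continuous y := continuous_iff_continuousAt.2 fun t => (hy t).continuousAt
  have hzc : Continuous z := continuous_iff_continuousAt.2 fun t => (hz t).continuousAt
  set K : Set ℂ := (fun t => y (t + a)) '' uIcc 0 s ∪ (fun t => z (t + b)) '' uIcc 0 s with hKdef
  have hK : IsCompact K := (isCompact_uIcc.image (by fun_prop)).union
    (isCompact_uIcc.image (by fun_prop))
  obtain ⟨L, hL⟩ := pb_lip hf K hK
  have := pb_gron hL (pb_shift hy a) (pb_shift hz b) s (fun t ht => Or.inl ⟨t, ht, rfl⟩)
    (fun t ht => Or.inr ⟨t, ht, rfl⟩)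
  simp only [zero_add, hab, dist_self, zero_mul] at this
  exact dist_le_zero.1 this

theorem pb_orbit {f : ℂ → ℂ} (hf : ContDiff ℝ 1 f) {K : Set ℂ} (hK : IsCompact K)
    {x : ℝ → ℂ} (hx : ∀ t, HasDerivAt x (f (x t)) t) (hxK : ∀ t : ℝ, 0 ≤ t → x t ∈ K)
    {q : ℂ} (hq : q ∈ pbOm x) :
    ∃ y : ℝ → ℂ, (∀ t, HasDerivAt y (f (y t)) t) ∧ y 0 = q ∧ ∀ t, y t ∈ pbOm x := by
  obtain ⟨L, hL⟩ := pb_lip hf K hK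
  have hsel : ∀ n : ℕ, ∃ t : ℝ, (n : ℝ) ≤ t ∧ dist (x t) q < 1 / ((n : ℝ) + 1) := fun n =>
    pbOm_iff.1 hq n _ (by positivity)
  choose τ hτ hτq using hsel
  have hlim : Tendsto (fun n => x (τ n)) atTop (𝓝 q) := by
    rw [tendsto_iff_dist_tendsto_zero]
    exact squeeze_zero (fun _ => dist_nonneg) (fun n => (hτq n).le)
      tendsto_one_div_add_atTop_nhds_zero_nat
  -- Gronwall estimate
  have hgr : ∀ s : ℝ, ∀ n m : ℕ, |s| ≤ n → |s| ≤ m →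
      dist (x (s + τ n)) (x (s + τ m)) ≤ dist (x (τ n)) (x (τ m)) * Real.exp (L * |s|) := by
    intro s n m hn hm
    have aux : ∀ k : ℕ, |s| ≤ k → ∀ t ∈ uIcc 0 s, x (t + τ k) ∈ K := by
      intro k hk t ht
      apply hxK
      have h1 := hτ k
      have h2 := (abs_le.1 hk).1
      have h3 : min 0 s ≤ t := ht.1
      have h4 : -(k : ℝ) ≤ min 0 s := le_min (by simp) h2
      linarith
    have := pb_gron hL (pb_shift hx (τ n)) (pb_shift hx (τ m)) s (aux n hn) (aux m hm)
    simpa using this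
  have hcau : ∀ s : ℝ, CauchySeq fun n => x (s + τ n) := by
    intro s
    rw [Metric.cauchySeq_iff]
    intro ε hε
    obtain ⟨N, hN⟩ := Metric.cauchySeq_iff.1 hlim.cauchySeq (ε / Real.exp (L * |s|)) (by positivity)
    obtain ⟨N', hN'⟩ := exists_nat_ge |s|
    refine ⟨max N N', fun m hm n hn => ?_⟩
    have c1 : ∀ k : ℕ, max N N' ≤ k → |s| ≤ k := fun k hk =>
      hN'.trans (by exact_mod_cast (le_max_right _ _).trans hk)
    refine (hgr s m n (c1 m hm) (c1 n hn)).trans_lt ?_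
    rw [← lt_div_iff₀ (Real.exp_pos _)]
    exact hN m ((le_max_left _ _).trans hm) n ((le_max_left _ _).trans hn)
  choose y hy using fun s => cauchySeq_tendsto_of_complete (hcau s)
  have hyd : ∀ s : ℝ, ∀ n : ℕ, |s| ≤ n →
      dist (x (s + τ n)) (y s) ≤ dist (x (τ n)) q * Real.exp (L * |s|) := by
    intro s n hn
    have l1 : Tendsto (fun m => dist (x (s + τ n)) (x (s + τ m))) atTop
      (𝓝 (dist (x (s + τ n)) (y s))) := tendsto_const_nhds.dist (hy s)
    have l2 : Tendsto (fun m => dist (x (τ n)) (x (τ m)) * Real.exp (L * |s|)) atTop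
      (𝓝 (dist (x (τ n)) q * Real.exp (L * |s|))) :=
      (tendsto_const_nhds.dist hlim).mul_const _
    refine le_of_tendsto_of_tendsto l1 l2 ?_
    obtain ⟨N', hN'⟩ := exists_nat_ge |s|
    filter_upwards [eventually_ge_atTop N'] with m hm
    exact hgr s n m hn (hN'.trans (by exact_mod_cast hm))
  have hyω : ∀ s, y s ∈ pbOm x := by
    intro s
    rw [pbOm_iff]
    intro T ε hε
    have e1 := (Metric.tendsto_nhds.1 (hy s)) ε hε
    obtain ⟨N', hN'⟩ := exists_nat_ge (T - s)
    obtain ⟨n, hn, hn2⟩ := (e1.and (eventually_ge_atTop N')).exists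
    refine ⟨s + τ n, ?_, hn⟩
    have : (N' : ℝ) ≤ n := by exact_mod_cast hn2
    linarith [hτ n]
  have hyK : ∀ s, y s ∈ K := fun s => pbOm_sub hK hxK (hyω s)
  refine ⟨y, ?_, ?_, hyω⟩
  · intro s
    obtain ⟨N, hN⟩ := exists_nat_gt |s|
    refine hasDerivAt_of_tendstoUniformlyOn (l := atTop) (s := Ioo (-(N : ℝ)) N)
      (f := fun n t => x (t + τ n)) (f' := fun n t => f (x (t + τ n)))
      (g' := fun t => f (y t)) isOpen_Ioo ?_ ?_ (fun t _ => hy t) (abs_lt.1 hN)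
    · rw [Metric.tendstoUniformlyOn_iff]
      intro ε hε
      have l3 : Tendsto (fun n => L * (dist (x (τ n)) q * Real.exp (L * N))) atTop (𝓝 0) := by
        have := ((tendsto_iff_dist_tendsto_zero.1 hlim).mul_const
          (Real.exp (L * N))).const_mul (L : ℝ)
        simpa using this
      filter_upwards [l3.eventually (gt_mem_nhds hε), eventually_ge_atTop N] with n hn hnN t ht
      have hnN' : (N : ℝ) ≤ n := by exact_mod_cast hnN
      have htN : |t| ≤ N := (abs_lt.2 ht).le
      rw [dist_comm]
      have htK : x (t + τ n) ∈ K := hxK _ (by linarith [hτ n, ht.1])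
      refine lt_of_le_of_lt ((hL.dist_le_mul _ htK _ (hyK t)).trans ?_) hn
      refine mul_le_mul_of_nonneg_left ((hyd t n (htN.trans hnN')).trans ?_) L.2
      gcongr
    · exact Eventually.of_forall fun n t _ => pb_shift hx (τ n) t
  · have := hy 0
    simp only [zero_add] at this
    exact tendsto_nhds_unique this hlim

theorem pb_hit {f : ℂ → ℂ} (hf : Continuous f) {K : Set ℂ} (hK : IsCompact K) {p r v : ℂ}
    (hv : v ≠ 0) (hp0 : ((p - r) / v).re = 0) (hpd : 0 < (f p / v).re) {ε : ℝ} (hε : 0 < ε) :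
    ∃ δ > 0, ∀ y : ℝ → ℂ, (∀ t, HasDerivAt y (f (y t)) t) → ∀ t0 : ℝ,
      (∀ t, |t - t0| ≤ ε → y t ∈ K) → dist (y t0) p < δ →
      ∃ s, |s - t0| < ε ∧ ((y s - r) / v).re = 0 ∧ dist (y s) p < ε := by
  obtain ⟨M0, hM0⟩ := hK.exists_bound_of_continuousOn hf.continuousOn
  set M := max M0 1 with hMdef
  have hM1 : 0 < M := lt_of_lt_of_le one_pos (le_max_right _ _)
  have hM : ∀ z ∈ K, ‖f z‖ ≤ M := fun z hz => (hM0 z hz).trans (le_max_left _ _)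
  set κ := (f p / v).re with hκ
  have hcont : ContinuousAt (fun z => (f z / v).re) p := by fun_prop
  obtain ⟨ρ, hρ, hρ'⟩ := Metric.eventually_nhds_iff.1
    (hcont.eventually (lt_mem_nhds (half_lt_self hpd)))
  set ε' := min ε ρ with hε'
  have hε'0 : 0 < ε' := lt_min hε hρ
  set η := min (ε / 2) (ε' / (2 * M)) with hη
  have hη0 : 0 < η := by positivity
  have hηε : η < ε := (min_le_left _ _).trans_lt (half_lt_self hε)
  have hMη : M * η ≤ ε' / 2 := by
    have : η ≤ ε' / (2 * M) := min_le_right _ _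
    calc M * η ≤ M * (ε' / (2 * M)) := by gcongr
      _ = ε' / 2 := by field_simp
  have hvn : 0 < ‖v‖ := norm_pos_iff.2 hv
  refine ⟨min (ε' / 2) (‖v‖ * (κ / 2 * η)), by positivity, ?_⟩
  intro y hy t0 hyK hd
  have hyc : Continuous y := continuous_iff_continuousAt.2 fun t => (hy t).continuousAt
  have hd1 : dist (y t0) p < ε' / 2 := hd.trans_le (min_le_left _ _)
  have hd2 : dist (y t0) p < ‖v‖ * (κ / 2 * η) := hd.trans_le (min_le_right _ _)
  have habs : ∀ t ∈ Icc (t0 - η) (t0 + η), |t - t0| ≤ η := fun t ht =>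
    abs_le.2 ⟨by linarith [ht.1], by linarith [ht.2]⟩
  have ht0 : t0 ∈ Icc (t0 - η) (t0 + η) := ⟨by linarith, by linarith⟩
  have hnear : ∀ t ∈ Icc (t0 - η) (t0 + η), dist (y t) p < ε' := by
    intro t ht
    have := (convex_Icc (t0 - η) (t0 + η)).norm_image_sub_le_of_norm_hasDerivWithin_le
      (f := y) (f' := fun t => f (y t)) (C := M) (fun s hs => (hy s).hasDerivWithinAt)
      (fun s hs => hM _ (hyK s ((habs s hs).trans hηε.le))) ht0 ht
    rw [← dist_eq_norm, Real.norm_eq_abs] at this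
    have h2 : M * |t - t0| ≤ M * η := by gcongr; exact habs t ht
    linarith [dist_triangle (y t) (y t0) p]
  set g : ℝ → ℝ := fun t => ((y t - r) / v).re with hg
  have hgd : ∀ t, HasDerivAt g ((f (y t) / v).re) t := fun t =>
    pb_hasDerivAt_re (((hy t).sub_const r).div_const v)
  have hgc : Continuous g := continuous_iff_continuousAt.2 fun t => (hgd t).continuousAt
  have hmv : ∀ a ∈ Icc (t0 - η) (t0 + η), ∀ b ∈ Icc (t0 - η) (t0 + η), a ≤ b →
      κ / 2 * (b - a) ≤ g b - g a := by
    refine (convex_Icc (t0 - η) (t0 + η)).mul_sub_le_image_sub_of_le_deriv hgc.continuousOn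
      (fun t _ => (hgd t).differentiableAt.differentiableWithinAt) ?_
    intro t ht
    rw [(hgd t).deriv]
    exact (hρ' ((hnear t (interior_subset ht)).trans_le (min_le_right _ _))).le
  have hg0 : |g t0| ≤ κ / 2 * η := by
    have e : g t0 = ((y t0 - p) / v).re := by
      have : (y t0 - r) / v = (y t0 - p) / v + (p - r) / v := by ring
      simp only [hg]
      rw [this, Complex.add_re, hp0, add_zero]
    rw [e]
    refine (Complex.abs_re_le_norm _).trans ?_
    rw [norm_div, div_le_iff₀ hvn, ← dist_eq_norm]
    linarith
  have hg0' := abs_le.1 hg0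
  have h1 := hmv (t0 - η) ⟨le_rfl, by linarith⟩ t0 ht0 (by linarith)
  have h2 := hmv t0 ht0 (t0 + η) ⟨by linarith, le_rfl⟩ (by linarith)
  have h1' : κ / 2 * (t0 - (t0 - η)) = κ / 2 * η := by ring
  have h2' : κ / 2 * (t0 + η - t0) = κ / 2 * η := by ring
  obtain ⟨s, hs, hs0⟩ := intermediate_value_Icc (by linarith : t0 - η ≤ t0 + η) hgc.continuousOn
    (show (0 : ℝ) ∈ Icc (g (t0 - η)) (g (t0 + η)) from ⟨by linarith, by linarith⟩)
  exact ⟨s, (habs s hs).trans_lt hηε, hs0, (hnear s hs).trans_le (min_le_left _ _)⟩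

theorem pb_section {f : ℂ → ℂ} (hf : ContDiff ℝ 1 f) {K : Set ℂ} (hK : IsCompact K)
    {x : ℝ → ℂ} (hx : ∀ t, HasDerivAt x (f (x t)) t) (hxK : ∀ t : ℝ, 0 ≤ t → x t ∈ K)
    (hinj : Function.Injective x) {r : ℂ} (hr : r ∈ pbOm x) (hfr : f r ≠ 0) :
    ∃ β > 0, ∀ p ∈ pbOm x, ((p - r) / f r).re = 0 → |((p - r) / f r).im| < β → p = r := by
  set v := f r with hv
  have hfc : Continuous f := hf.continuous
  have hvn : 0 < ‖v‖ := norm_pos_iff.2 hfr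
  have hcont : ContinuousAt (fun z => (f z / v).re) r := by fun_prop
  have h1 : (0 : ℝ) < (f r / v).re := by rw [← hv, div_self hfr]; simp
  obtain ⟨ρ, hρ, hρ'⟩ := Metric.eventually_nhds_iff.1 (hcont.eventually (lt_mem_nhds h1))
  set β := ρ / (2 * ‖v‖) with hβ
  have hβ0 : 0 < β := by positivity
  have hpos : ∀ z : ℂ, ((z - r) / v).re = 0 → |((z - r) / v).im| ≤ β → 0 < (f z / v).re := by
    intro z h0 him
    apply hρ'
    have e : ‖(z - r) / v‖ ≤ β := by
      have : (z - r) / v = ((((z - r) / v).im : ℝ) : ℂ) * Complex.I := by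
        apply Complex.ext
        · simp only [Complex.re_ofReal_mul, Complex.I_re, mul_zero]; exact h0
        · simp only [Complex.im_ofReal_mul, Complex.I_im, mul_one]
      rw [this, norm_mul, Complex.norm_I, mul_one, Complex.norm_real]
      exact him
    rw [norm_div, div_le_iff₀ hvn, ← dist_eq_norm] at e
    have : β * ‖v‖ = ρ / 2 := by rw [hβ]; field_simp
    linarith
  have hits : ∀ p ∈ pbOm x, ((p - r) / v).re = 0 → |((p - r) / v).im| < β → ∀ e > 0, ∀ T : ℝ,
      ∃ s, T < s ∧ ((x s - r) / v).re = 0 ∧ |((x s - r) / v).im - ((p - r) / v).im| < e := by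
    intro p hp h0 him e he T
    obtain ⟨δ, hδ, hh⟩ := pb_hit hfc hK (r := r) hfr h0 (hpos p h0 him.le)
      (ε := ‖v‖ * e) (by positivity)
    obtain ⟨t, ht, htd⟩ := pbOm_iff.1 hp (max T 0 + ‖v‖ * e) δ hδ
    have hT1 := le_max_left T 0
    have hT2 := le_max_right T 0
    obtain ⟨s, hs, hs0, hsd⟩ := hh x hx t (fun t' ht' => hxK t' (by
      have := (abs_le.1 ht').1
      linarith)) htd
    refine ⟨s, ?_, hs0, ?_⟩
    · have := (abs_lt.1 hs).1
      linarith
    · rw [← Complex.sub_im, ← sub_div]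
      refine (Complex.abs_im_le_norm _).trans_lt ?_
      rw [norm_div, div_lt_iff₀ hvn]
      have : x s - r - (p - r) = x s - p := by ring
      rw [this, ← dist_eq_norm]
      linarith
  have key : ∀ p1 ∈ pbOm x, ∀ p2 ∈ pbOm x, ((p1 - r) / v).re = 0 → |((p1 - r) / v).im| < β →
      ((p2 - r) / v).re = 0 → |((p2 - r) / v).im| < β →
      ((p1 - r) / v).im < ((p2 - r) / v).im → False := by
    intro p1 hp1 p2 hp2 a1 b1 a2 b2 hlt
    set m1 := ((p1 - r) / v).im
    set m2 := ((p2 - r) / v).im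
    set e := min ((m2 - m1) / 2) (min (β - |m1|) (β - |m2|)) with he
    have he0 : 0 < e := lt_min (by linarith) (lt_min (by linarith) (by linarith))
    have e1 : e ≤ (m2 - m1) / 2 := min_le_left _ _
    have e2 : e ≤ β - |m1| := (min_le_right _ _).trans (min_le_left _ _)
    have e3 : e ≤ β - |m2| := (min_le_right _ _).trans (min_le_right _ _)
    obtain ⟨s1, _, z1, w1⟩ := hits p1 hp1 a1 b1 e he0 0
    obtain ⟨s2, l2, z2, w2⟩ := hits p2 hp2 a2 b2 e he0 s1
    obtain ⟨s3, l3, z3, w3⟩ := hits p1 hp1 a1 b1 e he0 s2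
    have n1 := abs_le.1 (le_refl |m1|)
    have n2 := abs_le.1 (le_refl |m2|)
    change |_ - m1| < e at w1
    change |_ - m2| < e at w2
    change |_ - m1| < e at w3
    rw [abs_lt] at w1 w2 w3
    refine pb_mono (u := fun t => (x t - r) / v) (u' := fun t => f (x t) / v)
      (α := -β) (β := β) (fun t => ((hx t).sub_const r).div_const v) ?_ ?_ l2 l3 ?_ z1 z2 z3
      ⟨by linarith, by linarith⟩ ⟨by linarith, by linarith⟩ ⟨by linarith, by linarith⟩
      (by linarith) (by linarith)
    · have hxc : Continuous x := continuous_iff_continuousAt.2 fun t => (hx t).continuousAt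
      exact (hfc.comp hxc).div_const v
    · intro s t hst
      simp only at hst
      apply hinj
      have := (div_left_inj' hfr).1 hst
      exact sub_left_inj.1 this
    · intro t h0 h1
      exact hpos _ h0 (abs_le.2 h1)
  refine ⟨β, hβ0, ?_⟩
  intro p hp h0 him
  have z0 : ((r - r) / v).re = 0 := by simp
  have z1 : ((r - r) / v).im = 0 := by simp
  have z2 : |((r - r) / v).im| < β := by rw [z1, abs_zero]; exact hβ0
  rcases lt_trichotomy ((p - r) / v).im 0 with h | h | h
  · exact (key p hp r hr h0 him z0 z2 (by rwa [z1])).elim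
  · have : (p - r) / v = 0 := Complex.ext h0 h
    rcases div_eq_zero_iff.1 this with h' | h'
    · exact sub_eq_zero.1 h'
    · exact absurd h' hfr
  · exact (key r hr p hp z0 z2 h0 him (by rwa [z1])).elim

theorem pb_mem_cthick {S : Set ℂ} (hS : IsCompact S) (hne : S.Nonempty) {z : ℂ} {d : ℝ}
    (h : Metric.infDist z S ≤ d) : z ∈ Metric.cthickening d S := by
  obtain ⟨w, hw, e⟩ := hS.exists_infDist_eq_dist hne z
  exact Metric.mem_cthickening_of_dist_le z w d S hw (e ▸ h)

theorem pb_nonconst {f : ℂ → ℂ} {y : ℝ → ℂ} (hy : ∀ t, HasDerivAt y (f (y t)) t)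
    (h0 : f (y 0) ≠ 0) : ∃ a b, y a ≠ y b := by
  by_contra hcon
  push Not at hcon
  apply h0
  have h1 : HasDerivAt y 0 0 := by
    have : y = fun _ => y 0 := funext fun t => hcon t 0
    rw [this]; exact hasDerivAt_const _ _
  exact (hy 0).unique h1

theorem pb_local {f : ℂ → ℂ} (hf : ContDiff ℝ 1 f) {K : Set ℂ} (hK : IsCompact K)
    {x : ℝ → ℂ} (hx : ∀ t, HasDerivAt x (f (x t)) t) (hxK : ∀ t : ℝ, 0 ≤ t → x t ∈ K)
    (hinj : Function.Injective x) {r : ℂ} (hr : r ∈ pbOm x) (hfr : f r ≠ 0)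
    {ε : ℝ} (hε : 0 < ε) :
    ∃ δ > 0, ∀ y : ℝ → ℂ, (∀ t, HasDerivAt y (f (y t)) t) → (∀ t, y t ∈ pbOm x) → ∀ t,
      dist (y t) r < δ → ∃ s, |s - t| < ε ∧ y s = r := by
  obtain ⟨β, hβ, hsec⟩ := pb_section hf hK hx hxK hinj hr hfr
  have hvn : 0 < ‖f r‖ := norm_pos_iff.2 hfr
  obtain ⟨δ, hδ, hh⟩ := pb_hit hf.continuous hK (p := r) (r := r) hfr (by simp)
    (by rw [div_self hfr]; simp) (ε := min ε (‖f r‖ * β)) (by positivity)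
  refine ⟨δ, hδ, fun y hy hyω t ht => ?_⟩
  obtain ⟨s, hs, hs0, hsd⟩ := hh y hy t (fun t' _ => pbOm_sub hK hxK (hyω t')) ht
  refine ⟨s, hs.trans_le (min_le_left _ _), hsec _ (hyω s) hs0 ?_⟩
  refine (Complex.abs_im_le_norm _).trans_lt ?_
  rw [norm_div, div_lt_iff₀ hvn, ← dist_eq_norm]
  have := hsd.trans_le (min_le_right _ _)
  linarith

theorem pb_complex (f : ℂ → ℂ) (hf : ContDiff ℝ 1 f) (K : Set ℂ) (hK : IsCompact K)
    (hKf : ∀ p ∈ K, f p ≠ 0) (x : ℝ → ℂ) (hx : ∀ t, HasDerivAt x (f (x t)) t)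
    (hxK : ∀ t : ℝ, 0 ≤ t → x t ∈ K) :
    ∃ (p : ℝ → ℂ) (T : ℝ), 0 < T ∧ (∀ t, HasDerivAt p (f (p t)) t) ∧
      (∀ t, p (t + T) = p t) ∧ (∃ a b, p a ≠ p b) ∧ pbOm x = Set.range p := by
  have hxc : Continuous x := continuous_iff_continuousAt.2 fun t => (hx t).continuousAt
  by_cases hinj : Function.Injective x
  · -- non-periodic case
    have hωK := pbOm_sub hK hxK
    -- cluster points of sequences along x
    have clust : ∀ τ : ℕ → ℝ, (∀ n : ℕ, (n : ℝ) ≤ τ n) → ∃ w ∈ pbOm x, ∃ φ : ℕ → ℕ,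
        StrictMono φ ∧ Tendsto (fun n => x (τ (φ n))) atTop (𝓝 w) := by
      intro τ hτ
      obtain ⟨w, -, φ, hφ, hlim⟩ := hK.tendsto_subseq (x := fun n => x (τ n))
        (fun n => hxK _ ((Nat.cast_nonneg n).trans (hτ n)))
      refine ⟨w, ?_, φ, hφ, hlim⟩
      rw [pbOm_iff]
      intro T ε hε
      obtain ⟨N, hN⟩ := exists_nat_ge T
      obtain ⟨n, h1, h2⟩ := ((Metric.tendsto_nhds.1 hlim ε hε).and (eventually_ge_atTop N)).exists
      refine ⟨τ (φ n), ?_, h1⟩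
      have h3 : (N : ℝ) ≤ φ n := by exact_mod_cast h2.trans (hφ.id_le n)
      linarith [hτ (φ n)]
    obtain ⟨q, hq, -⟩ := clust (fun n => n) (fun n => le_rfl)
    obtain ⟨y, hy, hy0, hyω⟩ := pb_orbit hf hK hx hxK hq
    have hyc : Continuous y := continuous_iff_continuousAt.2 fun t => (hy t).continuousAt
    have hωc : IsCompact (pbOm x) := hK.of_isClosed_subset (pbOm_closed x) hωK
    -- y is periodic
    obtain ⟨r, hr, φ, hφ, hlim⟩ := hωc.tendsto_subseq (x := fun n : ℕ => y n) (fun n => hyω n)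
    obtain ⟨T, hT, hper⟩ : ∃ T > 0, Function.Periodic y T := by
      obtain ⟨δ, hδ, hloc⟩ := pb_local hf hK hx hxK hinj hr (hKf r (hωK hr)) (ε := 1 / 2) (by norm_num)
      obtain ⟨N, hN⟩ := (Metric.tendsto_atTop.1 hlim δ hδ)
      obtain ⟨s, hs, hsr⟩ := hloc y hy hyω _ (hN N le_rfl)
      obtain ⟨s', hs', hsr'⟩ := hloc y hy hyω _ (hN (N + 1) (Nat.le_succ N))
      have hlt : φ N + 1 ≤ φ (N + 1) := hφ (Nat.lt_succ_self N)
      have hlt' : (φ N : ℝ) + 1 ≤ φ (N + 1) := by exact_mod_cast hlt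
      have g1 := (abs_lt.1 hs).2
      have g2 := (abs_lt.1 hs').1
      refine ⟨s' - s, by linarith, fun t => ?_⟩
      have := pb_uniq hf hy hy (hsr.trans hsr'.symm) (t - s)
      rw [sub_add_cancel] at this
      rw [this]; congr 1; ring
    refine ⟨y, T, hT, hy, hper, pb_nonconst hy (hKf _ (hωK (hyω 0))), ?_⟩
    have hPc : IsCompact (range y) := by
      rw [← hper.image_Icc hT 0]
      exact isCompact_Icc.image hyc
    have hPne : (range y).Nonempty := range_nonempty y
    apply Subset.antisymm
    · -- clopen argument
      have hopen : ∀ r ∈ range y, ∃ δ > 0, ∀ z ∈ pbOm x, dist z r < δ → z ∈ range y := by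
        rintro _ ⟨a, rfl⟩
        obtain ⟨δ, hδ, hloc⟩ := pb_local hf hK hx hxK hinj (hyω a) (hKf _ (hωK (hyω a))) one_pos
        refine ⟨δ, hδ, fun z hz hzd => ?_⟩
        obtain ⟨w, hw, hw0, hwω⟩ := pb_orbit hf hK hx hxK hz
        obtain ⟨s, -, hs⟩ := hloc w hw hwω 0 (by rwa [hw0])
        have := pb_uniq hf hw hy hs (-s)
        rw [neg_add_cancel, hw0] at this
        exact ⟨_, this.symm⟩
      choose! δ hδ hδ' using hopen
      set O : Set ℂ := ⋃ r ∈ range y, Metric.ball r (δ r) with hO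
      have hOo : IsOpen O := isOpen_biUnion fun _ _ => Metric.isOpen_ball
      have hPO : range y ⊆ O := fun r hr => mem_biUnion hr (Metric.mem_ball_self (hδ r hr))
      have hOω : ∀ z ∈ pbOm x, z ∈ O → z ∈ range y := by
        intro z hz hzO
        obtain ⟨r, hr, hzr⟩ := mem_iUnion₂.1 hzO
        exact hδ' r hr z hz hzr
      obtain ⟨d, hd, hdO⟩ := hPc.exists_cthickening_subset_open hOo hPO
      intro z hz
      by_contra hzP
      have hfar : d < Metric.infDist z (range y) := by
        by_contra hcon
        exact hzP (hOω z hz (hdO (pb_mem_cthick hPc hPne (not_lt.1 hcon))))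
      have hgc : Continuous fun t => Metric.infDist (x t) (range y) :=
        (Metric.continuous_infDist_pt _).comp hxc
      have hex : ∀ n : ℕ, ∃ s : ℝ, (n : ℝ) ≤ s ∧ Metric.infDist (x s) (range y) = d := by
        intro n
        obtain ⟨a, ha, had⟩ := pbOm_iff.1 (hyω 0) n d hd
        obtain ⟨b, hb, hbd⟩ := pbOm_iff.1 hz a (Metric.infDist z (range y) - d) (by linarith)
        have ga : Metric.infDist (x a) (range y) ≤ d :=
          (Metric.infDist_le_dist_of_mem (mem_range_self 0)).trans had.le
        have gb : d ≤ Metric.infDist (x b) (range y) := by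
          have := Metric.infDist_le_infDist_add_dist (s := range y) (x := z) (y := x b)
          rw [dist_comm] at this
          linarith
        obtain ⟨s, hs, hsd⟩ := intermediate_value_Icc hb hgc.continuousOn ⟨ga, gb⟩
        exact ⟨s, ha.trans hs.1, hsd⟩
      choose τ hτ hτd using hex
      obtain ⟨w, hw, ψ, -, hψ⟩ := clust τ hτ
      have hwd : Metric.infDist w (range y) = d := by
        have h1 := ((Metric.continuous_infDist_pt (range y)).tendsto w).comp hψ
        refine tendsto_nhds_unique h1 ?_
        have : ((fun z => Metric.infDist z (range y)) ∘ fun n => x (τ (ψ n))) = fun _ => d :=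
          funext fun n => hτd (ψ n)
        rw [this]; exact tendsto_const_nhds
      have hwP : w ∈ range y :=
        hOω w hw (hdO (pb_mem_cthick hPc hPne hwd.le))
      rw [Metric.infDist_zero_of_mem hwP] at hwd
      exact hd.ne hwd
    · rintro _ ⟨t, rfl⟩
      exact hyω t
  · -- periodic case
    obtain ⟨T, hT, hper⟩ : ∃ T > 0, Function.Periodic x T := by
      have main : ∀ a b, x a = x b → a < b → ∃ T > 0, Function.Periodic x T := by
        intro a b hab hlt
        refine ⟨b - a, by linarith, fun t => ?_⟩
        have := pb_uniq hf hx hx hab (t - a)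
        rw [sub_add_cancel] at this
        rw [this]; congr 1; ring
      simp only [Function.Injective] at hinj
      push Not at hinj
      obtain ⟨a, b, hab, hne⟩ := hinj
      rcases lt_or_gt_of_ne hne with h | h
      · exact main a b hab h
      · exact main b a hab.symm h
    refine ⟨x, T, hT, hx, hper, pb_nonconst hx (hKf _ (hxK 0 le_rfl)), ?_⟩
    have hPc : IsCompact (range x) := by
      rw [← hper.image_Icc hT 0]
      exact isCompact_Icc.image hxc
    apply Subset.antisymm
    · intro z hz
      exact closure_minimal (image_subset_range _ _) hPc.isClosed
        (mem_iInter₂.1 hz 0 (mem_Ici.2 le_rfl))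
    · rintro _ ⟨s, rfl⟩
      rw [pbOm_iff]
      intro T0 ε hε
      obtain ⟨n, hn⟩ := exists_nat_ge ((T0 - s) / T)
      refine ⟨s + n * T, ?_, ?_⟩
      · rw [div_le_iff₀ hT] at hn
        linarith
      · rw [(hper.nat_mul n) s, dist_self]; exact hε

/-- Poincaré–Bendixson theorem: if `f : ℝ² → ℝ²` is continuously differentiable,
`K` is a compact set containing no zero of `f`, and `x` is a solution of
`x' = f ∘ x` with `x t ∈ K` for all `t ≥ 0`, then the ω-limit set
`⋂ s ≥ 0, closure {x t : t ≥ s}` is the image of some nonconstant periodic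
solution of the system. -/
theorem poincare_bendixson
    (f : ℝ × ℝ → ℝ × ℝ) (hf : ContDiff ℝ 1 f)
    (K : Set (ℝ × ℝ)) (hK : IsCompact K) (hKf : ∀ p ∈ K, f p ≠ 0)
    (x : ℝ → ℝ × ℝ) (hx : ∀ t, HasDerivAt x (f (x t)) t)
    (hxK : ∀ t : ℝ, 0 ≤ t → x t ∈ K) :
    ∃ (p : ℝ → ℝ × ℝ) (T : ℝ), 0 < T ∧
      (∀ t, HasDerivAt p (f (p t)) t) ∧
      (∀ t, p (t + T) = p t) ∧
      (∃ a b, p a ≠ p b) ∧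
      (⋂ s ∈ Set.Ici (0 : ℝ), closure (x '' Set.Ici s)) = Set.range p := by
  let e : ℂ ≃L[ℝ] ℝ × ℝ := Complex.equivRealProdCLM
  obtain ⟨p, T, hT, hp, hper, ⟨a, b, hab⟩, hω⟩ := pb_complex (fun z => e.symm (f (e z)))
    (e.symm.contDiff.comp (hf.comp e.contDiff)) (e.symm '' K)
    (hK.image e.symm.continuous)
    (by
      rintro _ ⟨k, hk, rfl⟩ h0
      rw [e.apply_symm_apply] at h0
      exact hKf k hk (by simpa using h0))
    (fun t => e.symm (x t))
    (fun t => by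
      have := e.symm.hasFDerivAt.comp_hasDerivAt t (hx t)
      simpa [Function.comp_def] using this)
    (fun t ht => ⟨x t, hxK t ht, rfl⟩)
  refine ⟨fun t => e (p t), T, hT, ?_, fun t => congrArg e (hper t), ⟨a, b, fun h => hab (e.injective h)⟩, ?_⟩
  · intro t
    have := e.hasFDerivAt.comp_hasDerivAt t (hp t)
    simpa [Function.comp_def] using this
  · have hmem : ∀ q : ℝ × ℝ, q ∈ (⋂ s ∈ Set.Ici (0 : ℝ), closure (x '' Set.Ici s)) ↔
        e.symm q ∈ pbOm (fun t => e.symm (x t)) := by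
      intro q
      simp only [pbOm, mem_iInter]
      refine forall₂_congr fun s _ => ?_
      have h1 : (fun t => e.symm (x t)) '' Ici s = e.symm '' (x '' Ici s) := by
        rw [image_image]
      have h2 : e.symm '' closure (x '' Ici s) = closure (e.symm '' (x '' Ici s)) :=
        e.symm.toHomeomorph.image_closure _
      rw [h1, ← h2]
      exact (e.symm.injective.mem_set_image).symm
    ext q
    rw [hmem, hω]
    constructor
    · rintro ⟨t, ht⟩
      exact ⟨t, by simp only [ht, e.apply_symm_apply]⟩
    · rintro ⟨t, rfl⟩
      exact ⟨t, by rw [e.symm_apply_apply]⟩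
end

section
/- Morse Lemma: let f : ℝⁿ → ℝ be smooth (C^∞), let m ∈ ℝⁿ be a critical point of f (the derivative of f at m vanishes) which is nondegenerate, and suppose the Hessian quadratic form v ↦ D²f(m)(v, v) has exactly μ negative eigenvalues and n − μ positive eigenvalues. Then there exist an open neighborhood U of m, an open neighborhood V of 0 in ℝⁿ, and a smooth diffeomorphism φ : U → V with φ(m) = 0 such that for all x ∈ U, f(x) − f(m) = −∑_{i=1}^{μ} φᵢ(x)² + ∑_{i=μ+1}^{n} φᵢ(x)². -/
open Set Filter Topology MeasureTheory
open scoped ContDiff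

lemma morse_param_hasFDerivAt {E F : Type} [NormedAddCommGroup E] [NormedSpace ℝ E]
    [FiniteDimensional ℝ E] [NormedAddCommGroup F] [NormedSpace ℝ F]
    (w : ℝ → ℝ) (hw : Continuous w) (G : E → F) (hG : ContDiff ℝ 1 G) (m y : E) :
    HasFDerivAt (fun y => ∫ t in (0:ℝ)..1, w t • G (m + t • y))
      (∫ t in (0:ℝ)..1, (w t * t) • fderiv ℝ G (m + t • y)) y := by
  have hG0 : Continuous G := hG.continuous
  have hG1 : Continuous (fderiv ℝ G) := hG.continuous_fderiv (by simp)
  have hcont : Continuous (fun p : E × ℝ => (w p.2 * p.2) • fderiv ℝ G (m + p.2 • p.1)) := by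
    fun_prop
  have hK : IsCompact ((Metric.closedBall y 1) ×ˢ (Icc (0:ℝ) 1)) :=
    (isCompact_closedBall y 1).prod isCompact_Icc
  obtain ⟨C, hC⟩ := hK.exists_bound_of_continuousOn hcont.continuousOn
  refine intervalIntegral.hasFDerivAt_integral_of_dominated_of_fderiv_le
    (F := fun y t => w t • G (m + t • y))
    (F' := fun y t => (w t * t) • fderiv ℝ G (m + t • y)) (bound := fun _ => C)
    (Metric.closedBall_mem_nhds y one_pos) ?_ ?_ ?_ ?_ ?_ ?_
  · refine Eventually.of_forall fun x => Continuous.aestronglyMeasurable ?_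
    fun_prop
  · apply Continuous.intervalIntegrable
    fun_prop
  · have : SecondCountableTopologyEither ℝ (E →L[ℝ] F) := ⟨Or.inl inferInstance⟩
    exact (hcont.comp (Continuous.prodMk_right y)).aestronglyMeasurable
  · refine Eventually.of_forall fun t ht x hx => ?_
    rw [uIoc_of_le zero_le_one] at ht
    exact hC (x, t) ⟨hx, ⟨ht.1.le, ht.2⟩⟩
  · simp
  · refine Eventually.of_forall fun t ht x hx => ?_
    have h1 : HasFDerivAt G (fderiv ℝ G (m + t • x)) (m + t • x) :=
      (hG.differentiable (by simp) _).hasFDerivAt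
    have h2 : HasFDerivAt (fun x : E => m + t • x) (t • ContinuousLinearMap.id ℝ E) x :=
      ((hasFDerivAt_id x).const_smul t).const_add m
    have h3 := (h1.comp x h2).const_smul (w t)
    convert! h3 using 1
    ext v
    simp [mul_smul]

lemma morse_param_contDiff_nat {E : Type} [NormedAddCommGroup E] [NormedSpace ℝ E]
    [FiniteDimensional ℝ E] (m : E) (k : ℕ) :
    ∀ (F : Type) [NormedAddCommGroup F] [NormedSpace ℝ F]
    (w : ℝ → ℝ) (_ : Continuous w) (G : E → F) (_ : ContDiff ℝ ∞ G),
    ContDiff ℝ k (fun y => ∫ t in (0:ℝ)..1, w t • G (m + t • y)) := by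
  induction k with
  | zero =>
    intro F _ _ w hw G hG
    have := hG.continuous
    rw [Nat.cast_zero, contDiff_zero]
    apply intervalIntegral.continuous_parametric_intervalIntegral_of_continuous'
    unfold Function.uncurry
    fun_prop
  | succ k ih =>
    intro F _ _ w hw G hG
    have hd := fun y => morse_param_hasFDerivAt w hw G (hG.of_le (by simp)) m y
    rw [Nat.cast_succ, contDiff_succ_iff_fderiv]
    refine ⟨fun y => (hd y).differentiableAt, by simp, ?_⟩
    have : fderiv ℝ (fun y => ∫ t in (0:ℝ)..1, w t • G (m + t • y)) =
      fun y => ∫ t in (0:ℝ)..1, (w t * t) • fderiv ℝ G (m + t • y) :=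
      funext fun y => (hd y).fderiv
    rw [this]
    exact ih _ (fun t => w t * t) (by fun_prop) _ (hG.fderiv_right (by simp))

lemma morse_param_contDiff {E F : Type} [NormedAddCommGroup E] [NormedSpace ℝ E]
    [FiniteDimensional ℝ E] (m : E) [NormedAddCommGroup F] [NormedSpace ℝ F]
    (w : ℝ → ℝ) (hw : Continuous w) (G : E → F) (hG : ContDiff ℝ ∞ G) :
    ContDiff ℝ ∞ (fun y => ∫ t in (0:ℝ)..1, w t • G (m + t • y)) :=
  contDiff_infty.2 fun k => morse_param_contDiff_nat m k F w hw G hG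

/-- Hadamard-type second order expansion. -/
lemma morse_hadamard {E : Type} [NormedAddCommGroup E] [NormedSpace ℝ E]
    [FiniteDimensional ℝ E] (f : E → ℝ) (hf : ContDiff ℝ ∞ f) (m : E)
    (hcrit : fderiv ℝ f m = 0) :
    ∃ B : E → E →L[ℝ] E →L[ℝ] ℝ, ContDiff ℝ ∞ B ∧ (∀ y v w, B y v w = B y w v) ∧
      B 0 = (1/2 : ℝ) • fderiv ℝ (fderiv ℝ f) m ∧ ∀ y, f (m + y) - f m = B y y y := by
  have hf1 : ContDiff ℝ ∞ (fderiv ℝ f) := hf.fderiv_right (by simp)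
  have hf2 : ContDiff ℝ ∞ (fderiv ℝ (fderiv ℝ f)) := hf1.fderiv_right (by simp)
  have hc2 := hf2.continuous
  have happ : ∀ y v w, (∫ t in (0:ℝ)..1, (1 - t) • fderiv ℝ (fderiv ℝ f) (m + t • y)) v w =
      ∫ t in (0:ℝ)..1, (1 - t) * fderiv ℝ (fderiv ℝ f) (m + t • y) v w := by
    intro y v w
    have hc : Continuous fun t : ℝ => (1 - t) • fderiv ℝ (fderiv ℝ f) (m + t • y) := by fun_prop
    have hcv : Continuous fun t : ℝ => ((1 - t) • fderiv ℝ (fderiv ℝ f) (m + t • y)) v := by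
      fun_prop
    rw [ContinuousLinearMap.intervalIntegral_apply (hc.intervalIntegrable _ _),
      ContinuousLinearMap.intervalIntegral_apply (hcv.intervalIntegrable _ _)]
    simp
  refine ⟨fun y => ∫ t in (0:ℝ)..1, (1 - t) • fderiv ℝ (fderiv ℝ f) (m + t • y),
    morse_param_contDiff m (fun t => 1 - t) (by fun_prop) _ hf2, ?_, ?_, ?_⟩
  · intro y v w
    rw [happ, happ]
    congr 1
    ext t
    have : IsSymmSndFDerivAt ℝ f (m + t • y) :=
      hf.contDiffAt.isSymmSndFDerivAt (by
        simp only [minSmoothness_of_isRCLikeNormedField]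
        exact WithTop.coe_le_coe.2 (le_top : (2 : ℕ∞) ≤ ⊤))
    rw [this v w]
  · ext v w
    rw [happ]
    simp only [smul_zero, add_zero]
    rw [intervalIntegral.integral_mul_const]
    have hi : ∫ x : ℝ in (0:ℝ)..1, (1 - x) = 1 / 2 := by
      rw [intervalIntegral.integral_sub (by simp) (by simp)]
      norm_num
    rw [hi]
    simp
  · intro y
    simp only
    rw [happ]
    have hd : ∀ t : ℝ, HasDerivAt (fun t : ℝ => (1 - t) * fderiv ℝ f (m + t • y) y + f (m + t • y))
        ((1 - t) * fderiv ℝ (fderiv ℝ f) (m + t • y) y y) t := by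
      intro t
      have hl : HasDerivAt (fun t : ℝ => m + t • y) y t := by
        simpa using ((hasDerivAt_id t).smul_const y).const_add m
      have h0 := ((hf.differentiable (by simp) (m + t • y)).hasFDerivAt).comp_hasDerivAt t hl
      have h1 := ((hf1.differentiable (by simp) (m + t • y)).hasFDerivAt).comp_hasDerivAt t hl
      have h2 := h1.clm_apply (hasDerivAt_const t y)
      have h3 := (((hasDerivAt_id t).const_sub 1).mul h2).add h0
      convert! h3 using 1
      simp
    rw [intervalIntegral.integral_eq_sub_of_hasDerivAt (fun t _ => hd t)
      (Continuous.intervalIntegrable (by fun_prop) _ _)]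
    simp [hcrit]

/-- Inverse function theorem with smooth inverse on the whole target. -/
lemma morse_ift {E F : Type} [NormedAddCommGroup E] [NormedSpace ℝ E] [CompleteSpace E]
    [NormedAddCommGroup F] [NormedSpace ℝ F]
    (g : E → F) (s : Set E) (hs : IsOpen s) (hg : ContDiffOn ℝ ∞ g s) (a : E) (ha : a ∈ s)
    (g' : E ≃L[ℝ] F) (hg' : HasFDerivAt g (g' : E →L[ℝ] F) a) :
    ∃ e : OpenPartialHomeomorph E F, (e : E → F) = g ∧ a ∈ e.source ∧ e.source ⊆ s ∧
      ContDiffOn ℝ ∞ e.symm e.target := by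
  have hga : ContDiffAt ℝ ∞ g a := hg.contDiffAt (hs.mem_nhds ha)
  set e0 := hga.toOpenPartialHomeomorph g hg' (by simp) with he0
  have he0c : (e0 : E → F) = g := rfl
  have hcd : ContinuousOn (fderiv ℝ g) s := hg.continuousOn_fderiv_of_isOpen hs (by simp)
  have hO : IsOpen (s ∩ fderiv ℝ g ⁻¹' (range ((↑) : (E ≃L[ℝ] F) → E →L[ℝ] F))) :=
    hcd.isOpen_inter_preimage hs ContinuousLinearEquiv.isOpen
  refine ⟨e0.restrOpen _ hO, ?_, ?_, ?_, ?_⟩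
  · ext x; simp [he0c]
  · refine ⟨hga.mem_toOpenPartialHomeomorph_source hg' (by simp), ha, ?_⟩
    exact ⟨g', hg'.fderiv.symm⟩
  · intro x hx
    exact hx.2.1
  · intro b hb
    have hx := (e0.restrOpen _ hO).map_target hb
    obtain ⟨_, hxs, g1, hg1⟩ := hx
    have hcx := hg.contDiffAt (hs.mem_nhds hxs)
    refine ContDiffAt.contDiffWithinAt ?_
    refine OpenPartialHomeomorph.contDiffAt_symm (f₀' := g1) _ hb ?_ ?_
    · rw [hg1]
      exact (hcx.differentiableAt (by simp)).hasFDerivAt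
    · exact hcx

/-- Smooth local square root near `1` in a Banach algebra. -/
lemma morse_sqrt (A : Type) [NormedRing A] [NormedAlgebra ℝ A] [CompleteSpace A] :
    ∃ e : OpenPartialHomeomorph A A, (∀ R, e R = R * R) ∧ 1 ∈ e.source ∧
      ContDiffOn ℝ ∞ e.symm e.target := by
  have hd : HasFDerivAt (fun R : A => R * R)
      ((ContinuousLinearEquiv.smulLeft (Units.mk0 (2:ℝ) two_ne_zero) :
        A ≃L[ℝ] A) : A →L[ℝ] A) 1 := by
    have h := (hasFDerivAt_id (𝕜 := ℝ) (1 : A)).mul' (hasFDerivAt_id (1 : A))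
    convert! h using 1
    ext R
    simp [two_smul, Units.smul_def]
  obtain ⟨e, he, h1, -, hsm⟩ := morse_ift (fun R : A => R * R) univ isOpen_univ
    (contDiff_id.mul contDiff_id).contDiffOn 1 (mem_univ _) _ hd
  exact ⟨e, fun R => congrFun he R, h1, hsm⟩

lemma morse_core {E : Type} [NormedAddCommGroup E] [NormedSpace ℝ E]
    [FiniteDimensional ℝ E] (B : E → E →L[ℝ] E →L[ℝ] ℝ) (hB : ContDiff ℝ ∞ B)
    (hsymm : ∀ y v w, B y v w = B y w v) (K : E ≃L[ℝ] (E →L[ℝ] ℝ)) (hK : ∀ v, K v = B 0 v) :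
    ∃ (s : Set E) (R : E → E →L[ℝ] E), IsOpen s ∧ 0 ∈ s ∧ ContDiffOn ℝ ∞ R s ∧
      R 0 = ContinuousLinearMap.id ℝ E ∧ ∀ y ∈ s, ∀ v, B 0 (R y v) (R y v) = B y v v := by
  have : CompleteSpace E := FiniteDimensional.complete ℝ E
  have hKs : ∀ v w, K v w = K w v := fun v w => by rw [hK, hK, hsymm]
  obtain ⟨e, he', h1, hsm⟩ := morse_sqrt (E →L[ℝ] E)
  set C : E → E →L[ℝ] E := fun y => (K.symm : (E →L[ℝ] ℝ) →L[ℝ] E).comp (B y) with hC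
  have hCs : ContDiff ℝ ∞ C := contDiff_const.clm_comp hB
  have hKC : ∀ y v w, K (C y v) w = B y v w := fun y v w => by simp [hC]
  have hC0 : C 0 = e 1 := by
    rw [he']
    ext v
    simp [hC, ← hK]
  set s0 := C ⁻¹' e.target with hs0
  have hs0o : IsOpen s0 := e.open_target.preimage hCs.continuous
  set R : E → E →L[ℝ] E := fun y => e.symm (C y) with hR
  have hRs : ContDiffOn ℝ ∞ R s0 := hsm.comp hCs.contDiffOn (fun y hy => hy)
  have hR0 : R 0 = 1 := by
    simp only [hR, hC0]
    exact e.left_inv h1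
  set T : (E →L[ℝ] E) → (E →L[ℝ] E) := fun A =>
    (K.symm : (E →L[ℝ] ℝ) →L[ℝ] E).comp
      (((ContinuousLinearMap.compL ℝ E E ℝ).flip A).comp (K : E →L[ℝ] (E →L[ℝ] ℝ))) with hT
  have hTc : Continuous T := by
    have : Continuous (ContinuousLinearMap.compL ℝ E E ℝ).flip :=
      ContinuousLinearMap.continuous _
    exact continuous_const.clm_comp (this.clm_comp continuous_const)
  have hKT : ∀ A v w, K (T A v) w = K v (A w) := fun A v w => by simp [hT]
  have hT1 : T 1 = 1 := by
    ext v
    apply K.injective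
    ext w
    rw [hKT]
    rfl
  refine ⟨s0 ∩ (fun y => T (R y)) ⁻¹' e.source, R, ?_, ?_, ?_, hR0, ?_⟩
  · exact (hTc.comp_continuousOn hRs.continuousOn).isOpen_inter_preimage hs0o e.open_source
  · refine ⟨?_, ?_⟩
    · change C 0 ∈ e.target
      rw [hC0]
      exact e.map_source h1
    · change T (R 0) ∈ e.source
      rw [hR0, hT1]
      exact h1
  · exact hRs.mono inter_subset_left
  · rintro y ⟨hy, hy'⟩ v
    have hRR : R y * R y = C y := by
      rw [← he']
      exact e.right_inv hy
    have hRR' : ∀ v, R y (R y v) = C y v := fun v => by rw [← hRR]; rfl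
    have hTT : e (T (R y)) = e (R y) := by
      rw [he', he', hRR]
      ext v
      apply K.injective
      ext w
      change K (T (R y) (T (R y) v)) w = _
      rw [hKT, hKT, hRR', hKs, hKC, hKC, hsymm]
    have hTR : T (R y) = R y := e.injOn hy' (e.map_target hy) hTT
    calc B 0 (R y v) (R y v) = K (T (R y) v) (R y v) := by rw [hTR, hK]
      _ = B y v v := by rw [hKT, hRR', hKs, hKC]

lemma morse_diag {n : ℕ} (H : Matrix (Fin n) (Fin n) ℝ) (hH : H.IsHermitian)
    (μ : ℕ) (hμn : μ ≤ n)
    (hneg : {i : Fin n | hH.eigenvalues i < 0}.ncard = μ)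
    (hpos : {i : Fin n | 0 < hH.eigenvalues i}.ncard = n - μ) :
    ∃ P : (Fin n → ℝ) ≃L[ℝ] (Fin n → ℝ), ∀ v, (1/2 : ℝ) * (v ⬝ᵥ H.mulVec v) =
        -(∑ i ∈ Finset.univ.filter (fun i : Fin n => (i : ℕ) < μ), (P v i) ^ 2) +
          ∑ i ∈ Finset.univ.filter (fun i : Fin n => μ ≤ (i : ℕ)), (P v i) ^ 2 := by
  classical
  set l := hH.eigenvalues with hl
  have hne : ∀ i, l i ≠ 0 := by
    have hdisj : Disjoint {i : Fin n | l i < 0} {i : Fin n | 0 < l i} := by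
      rw [Set.disjoint_left]
      intro i hi hi'
      exact lt_asymm (show l i < 0 from hi) hi'
    have hc := Set.ncard_union_eq hdisj
    rw [hneg, hpos, Nat.add_sub_cancel' hμn] at hc
    have hu : {i : Fin n | l i < 0} ∪ {i : Fin n | 0 < l i} = univ := by
      apply Set.eq_of_subset_of_ncard_le (subset_univ _)
      rw [hc, Set.ncard_univ]
      simp
    intro i
    have : i ∈ {i : Fin n | l i < 0} ∪ {i : Fin n | 0 < l i} := hu ▸ mem_univ i
    rcases this with h | h
    · exact ne_of_lt h
    · exact ne_of_gt h
  have hcard : Fintype.card {i : Fin n // (i : ℕ) < μ} = Fintype.card {i : Fin n // l i < 0} := by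
    have h1 : Fintype.card {i : Fin n // l i < 0} = μ := by
      rw [← hneg, ← Nat.card_coe_set_eq, Nat.card_eq_fintype_card]
      rfl
    rw [h1, Fintype.card_subtype, Fin.card_filter_val_lt, min_eq_right hμn]
  let e0 := Fintype.equivOfCardEq hcard
  let σ : Equiv.Perm (Fin n) := e0.extendSubtype
  have hσ1 : ∀ i : Fin n, (i : ℕ) < μ → l (σ i) < 0 := fun i hi => e0.extendSubtype_mem i hi
  have hσ2 : ∀ i : Fin n, μ ≤ (i : ℕ) → 0 < l (σ i) := fun i hi =>
    lt_of_le_of_ne (not_lt.1 (e0.extendSubtype_not_mem i (not_lt.2 hi))) (hne _).symm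
  set U : Matrix (Fin n) (Fin n) ℝ := (hH.eigenvectorUnitary : Matrix (Fin n) (Fin n) ℝ) with hU
  have hspec : H = U * Matrix.diagonal l * star U := by
    have := hH.spectral_theorem
    rw [Unitary.conjStarAlgAut_apply] at this
    exact this
  have hUU : U * star U = 1 := Unitary.coe_mul_star_self _
  let P0 : (Fin n → ℝ) →ₗ[ℝ] (Fin n → ℝ) :=
    { toFun := fun v i => Real.sqrt (|l (σ i)| / 2) * (star U).mulVec v (σ i)
      map_add' := fun v w => by
        ext i; simp [Matrix.mulVec_add, mul_add]
      map_smul' := fun c v => by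
        ext i; simp [Matrix.mulVec_smul]; ring }
  have hP0 : ∀ v i, P0 v i = Real.sqrt (|l (σ i)| / 2) * (star U).mulVec v (σ i) :=
    fun v i => rfl
  have hinj : Function.Injective P0 := by
    rw [injective_iff_map_eq_zero]
    intro v hv
    have h0 : (star U).mulVec v = 0 := by
      ext j
      have := congrFun hv (σ.symm j)
      rw [hP0] at this
      simp only [Equiv.apply_symm_apply, Pi.zero_apply, mul_eq_zero] at this
      rcases this with h | h
      · exfalso
        have : 0 < Real.sqrt (|l j| / 2) :=
          Real.sqrt_pos.2 (half_pos (abs_pos.2 (hne j)))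
        exact this.ne' h
      · exact h
    have : (U * star U).mulVec v = 0 := by
      rw [← Matrix.mulVec_mulVec, h0, Matrix.mulVec_zero]
    rwa [hUU, Matrix.one_mulVec] at this
  refine ⟨(LinearEquiv.ofInjectiveEndo P0 hinj).toContinuousLinearEquiv, fun v => ?_⟩
  have hPv : ∀ i, ((LinearEquiv.ofInjectiveEndo P0 hinj).toContinuousLinearEquiv v i) ^ 2 =
      |l (σ i)| / 2 * ((star U).mulVec v (σ i)) ^ 2 := by
    intro i
    change (P0 v i) ^ 2 = _
    rw [hP0, mul_pow, Real.sq_sqrt (by positivity)]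
  simp only [hPv]
  have hquad : v ⬝ᵥ H.mulVec v = ∑ i, l i * ((star U).mulVec v i) ^ 2 := by
    have hv : Matrix.vecMul v U = (star U).mulVec v := by
      rw [Matrix.star_eq_conjTranspose, Matrix.conjTranspose_eq_transpose_of_trivial,
        Matrix.mulVec_transpose]
    rw [hspec, ← Matrix.mulVec_mulVec, ← Matrix.mulVec_mulVec, Matrix.dotProduct_mulVec, hv]
    simp only [dotProduct, Matrix.mulVec_diagonal]
    refine Finset.sum_congr rfl fun i _ => ?_
    ring
  rw [hquad, ← Equiv.sum_comp σ, Finset.mul_sum,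
    ← Finset.sum_filter_add_sum_filter_not Finset.univ (fun i : Fin n => (i : ℕ) < μ)]
  simp only [not_lt, ← Finset.sum_neg_distrib]
  congr 1
  · refine Finset.sum_congr rfl fun i hi => ?_
    rw [abs_of_neg (hσ1 i (Finset.mem_filter.1 hi).2)]
    ring
  · refine Finset.sum_congr rfl fun i hi => ?_
    rw [abs_of_pos (hσ2 i (Finset.mem_filter.1 hi).2)]
    ring

/-- Morse Lemma: if `f : ℝⁿ → ℝ` is smooth, `m` is a nondegenerate critical point of
`f`, and the Hessian of `f` at `m` has exactly `μ` negative eigenvalues and `n - μ`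
positive eigenvalues, then there are open neighborhoods `U` of `m` and `W` of `0` and
a smooth diffeomorphism `φ : U → W` with `φ m = 0` such that on `U`,
`f x - f m = -∑_{i<μ} (φ x i)² + ∑_{i≥μ} (φ x i)²`. -/
theorem morse_lemma {n : ℕ}
    (f : (Fin n → ℝ) → ℝ) (hf : ContDiff ℝ (⊤ : ℕ∞) f)
    (m : Fin n → ℝ) (hcrit : fderiv ℝ f m = 0)
    (hnondeg : ∀ v : Fin n → ℝ,
      (∀ w : Fin n → ℝ, iteratedFDeriv ℝ 2 f m ![v, w] = 0) → v = 0)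
    (H : Matrix (Fin n) (Fin n) ℝ)
    (hHdef : ∀ i j, H i j = iteratedFDeriv ℝ 2 f m ![Pi.single i 1, Pi.single j 1])
    (hH : H.IsHermitian)
    (μ : ℕ) (hμn : μ ≤ n)
    (hneg : {i : Fin n | hH.eigenvalues i < 0}.ncard = μ)
    (hpos : {i : Fin n | 0 < hH.eigenvalues i}.ncard = n - μ) :
    ∃ (U W : Set (Fin n → ℝ)) (φ : (Fin n → ℝ) → (Fin n → ℝ)),
      IsOpen U ∧ m ∈ U ∧ IsOpen W ∧ (0 : Fin n → ℝ) ∈ W ∧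
      Set.BijOn φ U W ∧ ContDiffOn ℝ (⊤ : ℕ∞) φ U ∧
      (∃ ψ : (Fin n → ℝ) → (Fin n → ℝ),
        ContDiffOn ℝ (⊤ : ℕ∞) ψ W ∧ Set.LeftInvOn ψ φ U ∧ Set.RightInvOn ψ φ W) ∧
      φ m = 0 ∧
      ∀ x ∈ U, f x - f m =
        -(∑ i ∈ Finset.univ.filter (fun i : Fin n => (i : ℕ) < μ), (φ x i) ^ 2) +
          ∑ i ∈ Finset.univ.filter (fun i : Fin n => μ ≤ (i : ℕ)), (φ x i) ^ 2 := by
  classical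
  have hf' : ContDiff ℝ ∞ f := hf
  obtain ⟨B, hB, hsymm, hB0, hBf⟩ := morse_hadamard f hf' m hcrit
  have hit : ∀ v w, iteratedFDeriv ℝ 2 f m ![v, w] = fderiv ℝ (fderiv ℝ f) m v w := by
    intro v w
    rw [iteratedFDeriv_two_apply]
    simp
  have hBv : ∀ v w, B 0 v w = (1/2 : ℝ) * iteratedFDeriv ℝ 2 f m ![v, w] := by
    intro v w
    rw [hit, hB0]
    simp
  have hinj : Function.Injective (B 0 : (Fin n → ℝ) →ₗ[ℝ] ((Fin n → ℝ) →L[ℝ] ℝ)) := by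
    rw [injective_iff_map_eq_zero]
    intro v hv
    apply hnondeg v
    intro w
    have h := hBv v w
    have h2 : B 0 v = 0 := hv
    rw [h2] at h
    simpa using h.symm
  have hdim : Module.finrank ℝ (Fin n → ℝ) = Module.finrank ℝ ((Fin n → ℝ) →L[ℝ] ℝ) := by
    rw [← (LinearMap.toContinuousLinearMap (𝕜 := ℝ) (E := Fin n → ℝ) (F' := ℝ)).finrank_eq]
    exact (Subspace.dual_finrank_eq (K := ℝ) (V := Fin n → ℝ)).symm
  obtain ⟨s, R, hso, hs0, hRs, hR0, hRB⟩ := morse_core B hB hsymm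
    (LinearMap.linearEquivOfInjective _ hinj hdim).toContinuousLinearEquiv (fun v => rfl)
  obtain ⟨P, hP⟩ := morse_diag H hH μ hμn hneg hpos
  have hquad : ∀ z, B 0 z z = (1/2 : ℝ) * (z ⬝ᵥ H.mulVec z) := by
    intro z
    rw [hBv, hit]
    congr 1
    conv_lhs => rw [pi_eq_sum_univ' z]
    simp only [map_sum, map_smul, _root_.sum_apply, _root_.smul_apply,
      smul_eq_mul, dotProduct, Matrix.mulVec, hHdef, hit, Finset.mul_sum]
    rw [Finset.sum_comm]
    refine Finset.sum_congr rfl fun i _ => Finset.sum_congr rfl fun j _ => ?_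
    ring
  set s' : Set (Fin n → ℝ) := (fun x => x - m) ⁻¹' s with hs'
  have hs'o : IsOpen s' := hso.preimage (by fun_prop)
  have hms' : m ∈ s' := by simpa [hs'] using hs0
  set φ : (Fin n → ℝ) → (Fin n → ℝ) := fun x => P (R (x - m) (x - m)) with hφ
  have hsub : ContDiff ℝ ∞ (fun x : Fin n → ℝ => x - m) := contDiff_id.sub contDiff_const
  have hRc : ContDiffOn ℝ ∞ (fun x => R (x - m)) s' := hRs.comp hsub.contDiffOn (fun x hx => hx)
  have hφs : ContDiffOn ℝ ∞ φ s' := P.contDiff.comp_contDiffOn (hRc.clm_apply hsub.contDiffOn)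
  have hφd : HasFDerivAt φ (P : (Fin n → ℝ) →L[ℝ] (Fin n → ℝ)) m := by
    have h1 := ((hRc.contDiffAt (hs'o.mem_nhds hms')).differentiableAt (by simp)).hasFDerivAt
    have h2 : HasFDerivAt (fun x : Fin n → ℝ => x - m) (ContinuousLinearMap.id ℝ _) m :=
      (hasFDerivAt_id m).sub_const m
    have h3 := (P : (Fin n → ℝ) →L[ℝ] (Fin n → ℝ)).hasFDerivAt.comp m (h1.clm_apply h2)
    convert! h3 using 1
    ext v
    simp [hR0]
  obtain ⟨e, he, hme, hes, hsm⟩ := morse_ift φ s' hs'o hφs m hms' P hφd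
  have hφm : φ m = 0 := by simp [hφ]
  refine ⟨e.source, e.target, φ, e.open_source, hme, e.open_target, ?_, ?_, hφs.mono hes,
    ⟨e.symm, hsm, ?_, ?_⟩, hφm, ?_⟩
  · have := e.map_source hme
    rwa [he, hφm] at this
  · rw [← he]
    exact e.bijOn
  · rw [← he]
    exact e.leftInvOn
  · rw [← he]
    exact e.rightInvOn
  · intro x hx
    have h := hBf (x - m)
    rw [add_sub_cancel] at h
    rw [h, ← hRB _ (hes hx), hquad, hP]
end
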